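/- arXiv:1908.08315 — 11 statements merged into one kernel-verified Lean document; each statement's English description precedes it below -/
import Mathlib

section
/- Let E be a meet-semilattice with least element 0 and let π be an essentially tight representation of E on a set Ω. Then every π-essentially tight character on E is tight. -/
open Set

variable {E : Type*} [SemilatticeInf E] [OrderBot E] {Ω : Type*}

/-- `E^{X,Y} = {z ∈ E : z ≤ x ∀ x ∈ X, z ⊓ y = ⊥ ∀ y ∈ Y}`. -/
def interSec (X Y : Finset E) : Set E :=
  {z | (∀ x ∈ X, z ≤ x) ∧ (∀ y ∈ Y, z ⊓ y = ⊥)}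

/-- `Z` is a (finite) cover for `E^{X,Y}`. -/
def IsCoverFor (Z X Y : Finset E) : Prop :=
  (↑Z : Set E) ⊆ interSec X Y ∧
  ∀ e ∈ interSec X Y, e ≠ ⊥ → ∃ z ∈ Z, z ⊓ e ≠ ⊥

/-- A representation of the semilattice `E` in the power set of `Ω`. -/
def IsRepresentation (π : E → Set Ω) : Prop :=
  π ⊥ = ∅ ∧ ∀ e f : E, π (e ⊓ f) = π e ∩ π f

/-- `π(X,Y) = (⋂_{x∈X} π(x)) ∩ (⋂_{y∈Y} Ω∖π(y))`. -/
def piSet (π : E → Set Ω) (X Y : Finset E) : Set Ω :=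
  (⋂ x ∈ X, π x) ∩ (⋂ y ∈ Y, (π y)ᶜ)

/-- `π` is essentially tight: all defect sets of covers are finite. -/
def IsEssentiallyTightRep (π : E → Set Ω) : Prop :=
  ∀ X Y Z : Finset E, IsCoverFor Z X Y →
    (piSet π X Y \ ⋃ z ∈ Z, π z).Finite

/-- A character on `E` (a nonzero multiplicative `{0,1}`-valued map). -/
def IsCharacter (φ : E → Bool) : Prop :=
  φ ⊥ = false ∧ (∀ e f : E, φ (e ⊓ f) = (φ e && φ f)) ∧ ∃ e : E, φ e = true

/-- A tight character on `E`. -/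
def IsTightChar (φ : E → Bool) : Prop :=
  ∀ X Y Z : Finset E, IsCoverFor Z X Y →
    (∀ x ∈ X, φ x = true) → (∀ y ∈ Y, φ y = false) →
    ∃ z ∈ Z, φ z = true

/-- A `π`-essentially tight character on `E`: `φ(z) = max φ(wᵢ)` whenever the
symmetric difference `π(z) Δ (π(w₁) ∪ … ∪ π(w_n))` is finite. -/
def IsEssTightChar (π : E → Set Ω) (φ : E → Bool) : Prop :=
  ∀ (z : E) (W : Finset E),
    (symmDiff (π z) (⋃ w ∈ W, π w)).Finite →
    (φ z = true ↔ ∃ w ∈ W, φ w = true)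

/-- **Proposition (TwoEssTight).** Let `E` be a meet-semilattice with least element `0`
and `π` an essentially tight representation of `E` on a set `Ω`.  Then every
`π`-essentially tight character on `E` is tight. -/
theorem stmt_1 (π : E → Set Ω) (hrep : IsRepresentation π)
    (hess : IsEssentiallyTightRep π)
    (φ : E → Bool) (hchar : IsCharacter φ) (hφ : IsEssTightChar π φ) :
    IsTightChar φ := by
  classical
  obtain ⟨-, hmul, e, he⟩ := hchar
  obtain ⟨-, hinf⟩ := hrep
  intro X Y Z hZ hX hY
  have key : ∀ S : Finset E, (∀ x ∈ S, φ x = true) →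
      ∃ a, φ a = true ∧ ∀ x ∈ S, a ≤ x := by
    intro S
    induction S using Finset.induction_on with
    | empty => intro _; exact ⟨e, he, by simp⟩
    | insert b S hb ih =>
      intro h
      obtain ⟨a, ha, hle⟩ := ih (fun x hx => h x (Finset.mem_insert_of_mem hx))
      refine ⟨b ⊓ a, ?_, ?_⟩
      · rw [hmul, ha, h b (Finset.mem_insert_self _ _)]; rfl
      · intro x hx
        rcases Finset.mem_insert.1 hx with rfl | hx
        · exact inf_le_left
        · exact inf_le_right.trans (hle x hx)
  obtain ⟨a, ha, hle⟩ := key X hX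
  have hmono : ∀ u v : E, u ≤ v → π u ⊆ π v := by
    intro u v huv p hp
    have h := hinf u v
    rw [inf_eq_left.2 huv] at h
    rw [h] at hp
    exact hp.2
  have hfin : (symmDiff (π a) (⋃ w ∈ (Z ∪ Y).image (fun z => z ⊓ a), π w)).Finite := by
    refine (hess X Y Z hZ).subset ?_
    rintro p (⟨hpa, hn⟩ | ⟨hp, hn⟩)
    · have hn' : ∀ z ∈ Z ∪ Y, p ∉ π z := by
        intro z hz hpz
        apply hn
        refine Set.mem_iUnion₂.2 ⟨z ⊓ a, Finset.mem_image_of_mem _ hz, ?_⟩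
        rw [hinf]
        exact ⟨hpz, hpa⟩
      refine ⟨⟨Set.mem_iInter₂.2 fun x hx => hmono _ _ (hle x hx) hpa,
        Set.mem_iInter₂.2 fun y hy => hn' y (Finset.mem_union_right _ hy)⟩, ?_⟩
      intro h
      obtain ⟨z, hz, hpz⟩ := Set.mem_iUnion₂.1 h
      exact hn' z (Finset.mem_union_left _ hz) hpz
    · exfalso
      obtain ⟨w, hw, hpw⟩ := Set.mem_iUnion₂.1 hp
      obtain ⟨z, -, rfl⟩ := Finset.mem_image.1 hw
      exact hn (hmono _ _ inf_le_right hpw)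
  obtain ⟨w, hw, hφw⟩ := (hφ a _ hfin).1 ha
  obtain ⟨z, hz, rfl⟩ := Finset.mem_image.1 hw
  have hφz : φ z = true := by
    rw [hmul, ha, Bool.and_true] at hφw
    exact hφw
  rcases Finset.mem_union.1 hz with hz | hz
  · exact ⟨z, hz, hφz⟩
  · rw [hY z hz] at hφz
    exact absurd hφz Bool.false_ne_true
end

section
/- Let E be a meet-semilattice with least element 0 and let π be a representation of E on a set Ω such that every π-essentially tight character on E is tight. Then for every x ∈ E and every finite cover Z for x, the defect set π(x) ∖ ⋃_{z∈Z} π(z) is finite. -/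
open Set

variable {E : Type*} [SemilatticeInf E] [OrderBot E] {Ω : Type*}

/-- **Lemma (LemmaEssTight).** Let `E` be a meet-semilattice with least element `0` and `π`
a representation of `E` on a set `Ω` such that every `π`-essentially tight character on `E`
is tight.  Then for every `x ∈ E` and every finite cover `Z` for `x` (i.e. for
`E^{{x},∅}`), the defect set `π(x) ∖ ⋃_{z∈Z} π(z)` is finite. -/
theorem stmt_2 (π : E → Set Ω) (hrep : IsRepresentation π)
    (h : ∀ φ : E → Bool, IsCharacter φ → IsEssTightChar π φ → IsTightChar φ) :
    ∀ (x : E) (Z : Finset E), IsCoverFor Z {x} ∅ →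
      (π x \ ⋃ z ∈ Z, π z).Finite := by
  classical
  intro x Z hZ
  by_contra hinf
  set D : Set Ω := π x \ ⋃ z ∈ Z, π z with hD
  have hne : (Filter.cofinite ⊓ Filter.principal D).NeBot :=
    Set.Infinite.cofinite_inf_principal_neBot hinf
  let U : Ultrafilter Ω := Ultrafilter.of (Filter.cofinite ⊓ Filter.principal D)
  have hU : (U : Filter Ω) ≤ Filter.cofinite ⊓ Filter.principal D := Ultrafilter.of_le _
  have hDU : D ∈ U := hU (Filter.mem_inf_of_right (Filter.mem_principal_self D))
  have hfin : ∀ s : Set Ω, s.Finite → sᶜ ∈ U := fun s hs =>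
    hU (Filter.mem_inf_of_left hs.compl_mem_cofinite)
  have hxU : π x ∈ U := Filter.mem_of_superset hDU Set.diff_subset
  have hbU : ∀ W : Finset E, (⋃ w ∈ W, π w) ∈ U ↔ ∃ w ∈ W, π w ∈ U := fun W =>
    Ultrafilter.finite_biUnion_mem_iff W.finite_toSet
  have ht := h (fun e => decide (π e ∈ U)) ?_ ?_
  · obtain ⟨z, hz, hzU⟩ := ht {x} ∅ Z hZ (by simpa using hxU) (by simp)
    have hzU' : π z ∈ U := by simpa using hzU
    have h1 : D ∩ π z ∈ U := Filter.inter_mem hDU hzU'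
    have h2 : D ∩ π z = ∅ := by
      ext a
      simp only [hD, Set.mem_inter_iff, Set.mem_diff, Set.mem_iUnion, Set.mem_empty_iff_false,
        iff_false]
      rintro ⟨⟨_, h3⟩, h4⟩
      exact h3 ⟨z, hz, h4⟩
    rw [h2] at h1
    exact U.empty_notMem h1
  · refine ⟨?_, ?_, x, by simpa using hxU⟩
    · simp only [hrep.1, decide_eq_false_iff_not]
      exact U.empty_notMem
    · intro e f
      rw [← Bool.decide_and]
      simp only [hrep.2, decide_eq_decide]
      exact Filter.inter_mem_iff
  · intro z W hs
    simp only [decide_eq_true_eq]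
    rw [← hbU W]
    have hc := hfin _ hs
    constructor
    · intro h1
      filter_upwards [h1, hc] with a ha hb
      by_contra hn
      exact hb (Or.inl ⟨ha, hn⟩)
    · intro h1
      filter_upwards [h1, hc] with a ha hb
      by_contra hn
      exact hb (Or.inr ⟨ha, hn⟩)
end

section
/- Let E be a meet-semilattice with least element 0 and let π be a representation of E on a set Ω. Assume at least one of: (a) there is a finite subset {x₁,…,x_n} ⊆ E such that Ω ∖ (π(x₁) ∪ … ∪ π(x_n)) is finite; (b) E admits no finite cover, i.e., there is no finite subset Z ⊆ E such that every nonzero e ∈ E satisfies z ∧ e ≠ 0 for some z ∈ Z. Then the following are equivalent: (i) π is an essentially tight representation; (ii) every π-essentially tight character on E is tight. -/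
open Set

variable {E : Type*} [SemilatticeInf E] [OrderBot E] {Ω : Type*}

/-- **Proposition (NecSufEssTight).** Let `E` be a meet-semilattice with least element `0`
and `π` a representation of `E` on a set `Ω`.  Assume at least one of:
(a) there is a finite subset `{x₁,…,x_n} ⊆ E` with `Ω ∖ (π(x₁) ∪ … ∪ π(x_n))` finite; or
(b) `E` admits no finite cover.
Then the following are equivalent:
(i) `π` is an essentially tight representation;
(ii) every `π`-essentially tight character on `E` is tight. -/
theorem stmt_3 (π : E → Set Ω) (hrep : IsRepresentation π)
    (hab : (∃ F : Finset E, ((⋃ x ∈ F, π x)ᶜ : Set Ω).Finite) ∨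
           ¬ ∃ Z : Finset E, ∀ e : E, e ≠ ⊥ → ∃ z ∈ Z, z ⊓ e ≠ ⊥) :
    IsEssentiallyTightRep π ↔
      ∀ φ : E → Bool, IsCharacter φ → IsEssTightChar π φ → IsTightChar φ := by
  classical
  obtain ⟨h0, hinf⟩ := hrep
  have hmono : ∀ a b : E, a ≤ b → π a ⊆ π b := by
    intro a b hle
    have h := hinf a b
    rw [inf_eq_left.mpr hle] at h
    rw [h]
    exact Set.inter_subset_right
  constructor
  · intro hT φ ⟨hφ0, hφi, e, he⟩ hE X Y Z hZ hX hY
    -- an element below `X` with value one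
    have key : ∀ X : Finset E, (∀ x ∈ X, φ x = true) →
        ∃ g, φ g = true ∧ ∀ x ∈ X, g ≤ x := by
      intro X
      induction X using Finset.induction_on with
      | empty => intro _; exact ⟨e, he, by simp⟩
      | insert a s ha ih =>
        intro h
        obtain ⟨g, hg, hgs⟩ := ih (fun x hx => h x (Finset.mem_insert_of_mem hx))
        refine ⟨a ⊓ g, by rw [hφi, hg, h a (Finset.mem_insert_self _ _)]; rfl, ?_⟩
        intro x hx
        rcases Finset.mem_insert.mp hx with rfl | hx
        · exact inf_le_left
        · exact inf_le_right.trans (hgs x hx)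
    obtain ⟨g, hg, hgX⟩ := key X hX
    have hcov : IsCoverFor (Z.image (· ⊓ g)) {g} Y := by
      constructor
      · intro w hw
        obtain ⟨z, hz, rfl⟩ := Finset.mem_image.mp (Finset.mem_coe.mp hw)
        refine ⟨?_, ?_⟩
        · intro x hx
          rw [Finset.mem_singleton.mp hx]
          exact inf_le_right
        · intro y hy
          have := (hZ.1 (Finset.mem_coe.mpr hz)).2 y hy
          exact le_bot_iff.mp (this ▸ inf_le_inf_right y inf_le_left)
      · intro f hf hf0
        have hfg : f ≤ g := hf.1 g (Finset.mem_singleton_self g)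
        obtain ⟨z, hz, hzf⟩ := hZ.2 f ⟨fun x hx => hfg.trans (hgX x hx), hf.2⟩ hf0
        refine ⟨z ⊓ g, Finset.mem_image_of_mem _ hz, ?_⟩
        rw [inf_assoc, inf_eq_right.mpr hfg]
        exact hzf
    have hfin := hT _ _ _ hcov
    have := (hE g (Z.image (· ⊓ g) ∪ Y.image (· ⊓ g)) (hfin.subset ?_)).mp hg
    · obtain ⟨w, hw, hw1⟩ := this
      rcases Finset.mem_union.mp hw with hw | hw
      · obtain ⟨z, hz, rfl⟩ := Finset.mem_image.mp hw
        rw [hφi, Bool.and_eq_true] at hw1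
        exact ⟨z, hz, hw1.1⟩
      · obtain ⟨y, hy, rfl⟩ := Finset.mem_image.mp hw
        rw [hφi, hY y hy] at hw1
        simp at hw1
    · intro p hp
      rcases hp with ⟨hp, hn⟩ | ⟨hp, hn⟩
      · simp only [Set.mem_iUnion, not_exists] at hn
        refine ⟨⟨by simpa using hp, ?_⟩, ?_⟩
        · simp only [Set.mem_iInter, Set.mem_compl_iff]
          intro y hy hpy
          refine hn (y ⊓ g) (Finset.mem_union_right _ (Finset.mem_image_of_mem _ hy)) ?_
          rw [hinf]; exact ⟨hpy, hp⟩
        · simp only [Set.mem_iUnion, not_exists]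
          intro w hw
          exact hn w (Finset.mem_union_left _ hw)
      · exfalso
        simp only [Set.mem_iUnion] at hp
        obtain ⟨w, hw, hpw⟩ := hp
        refine hn (hmono w g ?_ hpw)
        rcases Finset.mem_union.mp hw with hw | hw <;>
        · obtain ⟨z, hz, rfl⟩ := Finset.mem_image.mp hw
          exact inf_le_right
  · intro hC X Y Z hZ
    by_contra hinfin
    have hne := Set.Infinite.cofinite_inf_principal_neBot hinfin
    let U : Ultrafilter Ω := @Ultrafilter.of _ _ hne
    have hU : (U : Filter Ω) ≤ Filter.cofinite ⊓ Filter.principal _ :=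
      @Ultrafilter.of_le _ _ hne
    have hD : (piSet π X Y \ ⋃ z ∈ Z, π z) ∈ U :=
      Filter.le_principal_iff.mp (hU.trans inf_le_right)
    have hcof : ∀ s : Set Ω, s.Finite → s ∉ U := by
      intro s hs hsU
      have h1 : sᶜ ∈ U := (hU.trans inf_le_left) hs.compl_mem_cofinite
      exact (Ultrafilter.compl_mem_iff_notMem.mp h1) hsU
    have hUn : ∀ W : Finset E, (⋃ w ∈ W, π w) ∈ U ↔ ∃ w ∈ W, π w ∈ U := fun W =>
      Ultrafilter.finite_biUnion_mem_iff (f := U) (is := (W : Set E)) (s := π) W.finite_toSet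
    have hXU : ∀ x ∈ X, π x ∈ U := fun x hx =>
      Filter.mem_of_superset hD (fun p hp => by
        have := hp.1.1
        simp only [Set.mem_iInter] at this
        exact this x hx)
    have hYU : ∀ y ∈ Y, π y ∉ U := fun y hy => by
      rw [← Ultrafilter.compl_mem_iff_notMem]
      exact Filter.mem_of_superset hD (fun p hp => by
        have := hp.1.2
        simp only [Set.mem_iInter] at this
        exact this y hy)
    have hZU : ∀ z ∈ Z, π z ∉ U := fun z hz => by
      rw [← Ultrafilter.compl_mem_iff_notMem]
      exact Filter.mem_of_superset hD (fun p hp hpz =>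
        hp.2 (Set.mem_biUnion (Finset.mem_coe.mpr hz) hpz))
    have hex : ∃ e, π e ∈ U := by
      rcases hab with ⟨F, hF⟩ | hb
      · have h1 := Ultrafilter.compl_mem_iff_notMem.mpr (hcof _ hF)
        rw [compl_compl] at h1
        obtain ⟨w, _, hw⟩ := (hUn F).mp h1
        exact ⟨w, hw⟩
      · rcases X.eq_empty_or_nonempty with rfl | ⟨x, hx⟩
        · exfalso
          refine hb ⟨Z ∪ Y, fun e he => ?_⟩
          by_cases h : ∀ y ∈ Y, e ⊓ y = ⊥
          · obtain ⟨z, hz, hze⟩ := hZ.2 e ⟨by simp, h⟩ he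
            exact ⟨z, Finset.mem_union_left _ hz, hze⟩
          · push Not at h
            obtain ⟨y, hy, hye⟩ := h
            exact ⟨y, Finset.mem_union_right _ hy, by rwa [inf_comm]⟩
        · exact ⟨x, hXU x hx⟩
    have hchar : IsCharacter (fun e => decide (π e ∈ U)) := by
      refine ⟨?_, ?_, ?_⟩
      · simp only [decide_eq_false_iff_not, h0]
        exact hcof _ Set.finite_empty
      · intro e f
        rw [Bool.eq_iff_iff]
        simp only [Bool.and_eq_true, decide_eq_true_eq, hinf]
        exact Filter.inter_mem_iff
      · obtain ⟨e, he⟩ := hex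
        exact ⟨e, by simpa using he⟩
    have hess : IsEssTightChar π (fun e => decide (π e ∈ U)) := by
      intro z W hW
      simp only [decide_eq_true_eq]
      rw [← hUn W]
      have hc := Ultrafilter.compl_mem_iff_notMem.mpr (hcof _ hW)
      constructor
      · intro h
        filter_upwards [h, hc] with p h1 h2
        by_contra h3
        exact h2 (Or.inl ⟨h1, h3⟩)
      · intro h
        filter_upwards [h, hc] with p h1 h2
        by_contra h3
        exact h2 (Or.inr ⟨h1, h3⟩)
    obtain ⟨z, hz, h⟩ := hC _ hchar hess X Y Z hZ
      (fun x hx => by simpa using hXU x hx) (fun y hy => by simpa using hYU y hy)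
    exact hZU z hz (by simpa using h)
end

section
/- For i = 1, 2 let Λᵢ be a finite set of words over Σ, each of which is either empty or belongs to L_X, with at least one element of Λᵢ in L_X, and let uᵢ, vᵢ ∈ Λᵢ. Let Gᵢ := {(vᵢs, uᵢs) : s ∈ F_{Λᵢ}} ⊆ L_X × L_X be the graph of the partial bijection θ_{uᵢ} f_{Λᵢ} θ_{vᵢ}⁻¹ of L_X (with domain vᵢF_{Λᵢ} and rule vᵢs ↦ uᵢs). If G₁ = G₂ and G₁ ≠ ∅, then u₁ = u₂, v₁ = v₂ and F_{Λ₁} = F_{Λ₂}. -/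
open Set

variable {α : Type*}

/-- The left shift map on infinite words. -/
def lshift (x : ℕ → α) : ℕ → α := fun n => x (n + 1)

/-- The finite word `w` occurs as a consecutive block of the infinite word `x`. -/
def OccursIn (w : List α) (x : ℕ → α) : Prop :=
  ∃ k : ℕ, ∀ i : Fin w.length, w.get i = x (k + (i : ℕ))

/-- The language of `X`: all nonempty finite words occurring as a consecutive block
of some member of `X`. -/
def language (X : Set (ℕ → α)) : Set (List α) :=
  {w | w ≠ [] ∧ ∃ x ∈ X, OccursIn w x}

/-- `F_Λ = {s ∈ L_X : ts ∈ L_X for every t ∈ Λ}`. -/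
def FLam (X : Set (ℕ → α)) (Λ : Finset (List α)) : Set (List α) :=
  {s | s ∈ language X ∧ ∀ t ∈ Λ, t ++ s ∈ language X}

/-- The constructible subsets of the language: `∅` and the sets `uF_Λ` with `Λ` a finite
set of words, each empty or in `L_X`, at least one in `L_X`, and `u ∈ Λ`. -/
def Constructible (X : Set (ℕ → α)) (A : Set (List α)) : Prop :=
  A = ∅ ∨ ∃ (Λ : Finset (List α)) (u : List α),
    (∀ t ∈ Λ, t = [] ∨ t ∈ language X) ∧ (∃ t ∈ Λ, t ∈ language X) ∧ u ∈ Λ ∧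
    A = (fun s => u ++ s) '' FLam X Λ

/-- `σ_ω`: the set of nonempty finite prefixes of the infinite word `ω`. -/
def infPrefixes (ω : ℕ → α) : Set (List α) :=
  {w | w ≠ [] ∧ ∀ i : Fin w.length, w.get i = ω (i : ℕ)}

/-- Concatenation of a finite word with an infinite word. -/
def wcat (w : List α) (x : ℕ → α) : ℕ → α :=
  fun n => if h : n < w.length then w.get ⟨n, h⟩ else x (n - w.length)

theorem language_prefix {α : Type*} {X : Set (ℕ → α)} {w r : List α} (hw : w ≠ [])
    (h : w ++ r ∈ language X) : w ∈ language X := by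
  obtain ⟨_, x, hx, k, hk⟩ := h
  refine ⟨hw, x, hx, k, fun i => ?_⟩
  have := hk ⟨i, by have := i.2; simp; omega⟩
  simpa [List.getElem_append_left] using this

theorem FLam_head {α : Type*} {X : Set (ℕ → α)} {Λ : Finset (List α)} {s : List α}
    (hs : s ∈ FLam X Λ) : ∃ a, [a] ∈ FLam X Λ := by
  cases s with
  | nil => exact absurd rfl hs.1.1
  | cons a r =>
    refine ⟨a, language_prefix (r := r) (by simp) (by simpa using hs.1), fun t ht => ?_⟩
    exact language_prefix (r := r) (by simp) (by simpa using hs.2 t ht)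

theorem len_aux {α : Type*} {X : Set (ℕ → α)} {Λ Λ' : Finset (List α)} {u v u' v' s : List α}
    (hs : s ∈ FLam X Λ)
    (h : ∀ s ∈ FLam X Λ, ∃ s' ∈ FLam X Λ', (v ++ s, u ++ s) = (v' ++ s', u' ++ s')) :
    v'.length ≤ v.length ∧ u'.length ≤ u.length := by
  obtain ⟨a, ha⟩ := FLam_head hs
  obtain ⟨s', hs', he⟩ := h _ ha
  have hp := List.length_pos_iff.2 hs'.1.1
  have e1 := congrArg (fun p => p.1.length) he
  have e2 := congrArg (fun p => p.2.length) he
  simp at e1 e2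
  omega

/-- **Proposition (SubshiftUniqueness).** Let `X` be a subshift over a finite alphabet.
For `i = 1,2` let `Λᵢ` be a finite set of words, each empty or in `L_X`, with at least one
element in `L_X`, and `uᵢ, vᵢ ∈ Λᵢ`.  Let `Gᵢ = {(vᵢs, uᵢs) : s ∈ F_{Λᵢ}}` be the graph of
the partial bijection `θ_{uᵢ} f_{Λᵢ} θ_{vᵢ}⁻¹`.  If `G₁ = G₂ ≠ ∅` then `u₁ = u₂`,
`v₁ = v₂` and `F_{Λ₁} = F_{Λ₂}`. -/
theorem stmt_4 {α : Type*} [Finite α] [TopologicalSpace α] [DiscreteTopology α]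
    (X : Set (ℕ → α)) (hcl : IsClosed X) (hsh : ∀ x ∈ X, lshift x ∈ X)
    (Λ₁ Λ₂ : Finset (List α))
    (h₁ : ∀ t ∈ Λ₁, t = [] ∨ t ∈ language X) (h₁' : ∃ t ∈ Λ₁, t ∈ language X)
    (h₂ : ∀ t ∈ Λ₂, t = [] ∨ t ∈ language X) (h₂' : ∃ t ∈ Λ₂, t ∈ language X)
    (u₁ v₁ : List α) (hu₁ : u₁ ∈ Λ₁) (hv₁ : v₁ ∈ Λ₁)
    (u₂ v₂ : List α) (hu₂ : u₂ ∈ Λ₂) (hv₂ : v₂ ∈ Λ₂)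
    (hG : {p : List α × List α | ∃ s ∈ FLam X Λ₁, p = (v₁ ++ s, u₁ ++ s)} =
          {p : List α × List α | ∃ s ∈ FLam X Λ₂, p = (v₂ ++ s, u₂ ++ s)})
    (hne : {p : List α × List α | ∃ s ∈ FLam X Λ₁, p = (v₁ ++ s, u₁ ++ s)}.Nonempty) :
    u₁ = u₂ ∧ v₁ = v₂ ∧ FLam X Λ₁ = FLam X Λ₂ := by
  have a : ∀ s ∈ FLam X Λ₁, ∃ s' ∈ FLam X Λ₂, (v₁ ++ s, u₁ ++ s) = (v₂ ++ s', u₂ ++ s') :=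
    fun s hs => hG.subset ⟨s, hs, rfl⟩
  have b : ∀ s ∈ FLam X Λ₂, ∃ s' ∈ FLam X Λ₁, (v₂ ++ s, u₂ ++ s) = (v₁ ++ s', u₁ ++ s') :=
    fun s hs => hG.superset ⟨s, hs, rfl⟩
  obtain ⟨p, s, hs, -⟩ := hne
  obtain ⟨s', hs', he⟩ := a s hs
  obtain ⟨l1, l2⟩ := len_aux hs a
  obtain ⟨l3, l4⟩ := len_aux hs' b
  rw [Prod.mk.injEq] at he
  obtain ⟨rfl, -⟩ := List.append_inj he.1 (by omega)
  obtain ⟨rfl, -⟩ := List.append_inj he.2 (by omega)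
  refine ⟨rfl, rfl, Set.Subset.antisymm (fun t ht => ?_) (fun t ht => ?_)⟩
  · obtain ⟨t', ht', e⟩ := a t ht
    rw [Prod.mk.injEq] at e
    exact List.append_cancel_left e.1 ▸ ht'
  · obtain ⟨t', ht', e⟩ := b t ht
    rw [Prod.mk.injEq] at e
    exact List.append_cancel_left e.1 ▸ ht'
end

section
/- Let ω ∈ X, let Λ be a finite set of words over Σ, each of which is either empty or belongs to L_X, with at least one element of Λ in L_X, let u ∈ Λ, and let A = uF_Λ := {us : s ∈ F_Λ} (a constructible set written in normal form). Then the following are equivalent: (i) φ_ω(A) = 1, i.e., σ_ω ∖ A is finite; (ii) u is a prefix of ω and, writing ω = uη with η ∈ Σ^ℕ (i.e., η_k = ω_{|u|+k}), one has tη ∈ X for every t ∈ Λ. -/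
open Set

variable {α : Type*}

theorem aux_shift {α : Type*} (X : Set (ℕ → α)) (hsh : ∀ x ∈ X, lshift x ∈ X) (k : ℕ) :
    ∀ x ∈ X, (fun n => x (k + n)) ∈ X := by
  induction k with
  | zero => intro x hx; simpa using hx
  | succ k ih =>
    intro x hx
    have := ih _ (hsh x hx)
    have e : (fun n => x (k + 1 + n)) = (fun n => lshift x (k + n)) := by
      funext n
      simp only [lshift]
      congr 1
      omega
    rw [e]; exact this

theorem aux_closed {α : Type*} [TopologicalSpace α] [DiscreteTopology α]
    (X : Set (ℕ → α)) (hcl : IsClosed X) (x : ℕ → α)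
    (h : ∀ m : ℕ, ∃ y ∈ X, ∀ i < m, y i = x i) : x ∈ X := by
  choose y hy hyx using h
  refine hcl.mem_of_tendsto (b := Filter.atTop) (f := y) ?_ (Filter.Eventually.of_forall hy)
  rw [tendsto_pi_nhds]
  intro i
  apply tendsto_const_nhds.congr'
  filter_upwards [Filter.eventually_gt_atTop i] with m hm
  exact (hyx m i hm).symm

/-- **Proposition (DescribeCharsAsWords).** Let `X` be a subshift over a finite alphabet,
`ω ∈ X`, `Λ` a finite set of words each empty or in `L_X` with at least one in `L_X`,
`u ∈ Λ`, and `A = uF_Λ` (a constructible set in normal form).  The following are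
equivalent:
(i) `φ_ω(A) = 1`, i.e. `σ_ω ∖ A` is finite;
(ii) `u` is a prefix of `ω` and, writing `ω = uη` with `η_k = ω_{|u|+k}`, one has
`tη ∈ X` for every `t ∈ Λ`. -/
theorem stmt_6 {α : Type*} [Finite α] [TopologicalSpace α] [DiscreteTopology α]
    (X : Set (ℕ → α)) (hcl : IsClosed X) (hsh : ∀ x ∈ X, lshift x ∈ X)
    (ω : ℕ → α) (hω : ω ∈ X)
    (Λ : Finset (List α)) (hΛ : ∀ t ∈ Λ, t = [] ∨ t ∈ language X)
    (hΛ' : ∃ t ∈ Λ, t ∈ language X) (u : List α) (hu : u ∈ Λ) :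
    (infPrefixes ω \ (fun s => u ++ s) '' FLam X Λ).Finite ↔
      ((∀ i : Fin u.length, u.get i = ω (i : ℕ)) ∧
        ∀ t ∈ Λ, wcat t (fun k => ω (u.length + k)) ∈ X) := by
  constructor
  · intro hf
    have key : ∀ m : ℕ, ∃ s ∈ FLam X Λ, m ≤ s.length ∧
        ∀ (i : ℕ) (h : i < (u ++ s).length), (u ++ s)[i] = ω i := by
      intro m
      by_contra hcon
      push Not at hcon
      have hinj : Function.Injective
          (fun n : ℕ => (List.range (u.length + m + 1 + n)).map ω) := by
        intro a b hab
        have := congrArg List.length hab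
        simpa using this
      refine Set.infinite_range_of_injective hinj (hf.subset ?_)
      rintro _ ⟨n, rfl⟩
      refine ⟨⟨?_, ?_⟩, ?_⟩
      · intro h0
        have := congrArg List.length h0
        simp at this
      · intro i
        simp
      · rintro ⟨s, hs, hse⟩
        simp only at hse
        have hl := congrArg List.length hse
        simp at hl
        obtain ⟨i, h, hne⟩ := hcon s hs (by omega)
        apply hne
        simp [hse]
    refine ⟨?_, ?_⟩
    · obtain ⟨s, -, -, h⟩ := key 0
      intro i
      have := h i (by have := i.2; simp; omega)
      rw [List.getElem_append_left i.2] at this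
      simpa using this
    · intro t ht
      apply aux_closed X hcl
      intro m
      obtain ⟨s, hs, hm, h⟩ := key m
      obtain ⟨-, x, hx, k, hk⟩ := hs.2 t ht
      refine ⟨_, aux_shift X hsh k x hx, ?_⟩
      intro i hi
      have hil : i < (t ++ s).length := by simp; omega
      have h1 := hk ⟨i, hil⟩
      simp only [List.get_eq_getElem] at h1
      simp only [wcat]
      rw [← h1]
      split_ifs with hit
      · simp [List.getElem_append_left hit]
      · have h2 := h (u.length + (i - t.length)) (by simp at hil ⊢; omega)
        rw [List.getElem_append_right (by omega)] at h2
        rw [List.getElem_append_right (by omega), ← h2]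
        simp
  · rintro ⟨hpre, hX⟩
    refine (List.finite_length_le α u.length).subset ?_
    rintro w ⟨⟨hw0, hw⟩, hwA⟩
    simp only [Set.mem_setOf_eq]
    by_contra hlen
    push Not at hlen
    apply hwA
    have hd : ∀ (j : ℕ) (h : j < (w.drop u.length).length),
        (w.drop u.length)[j] = ω (u.length + j) := by
      intro j h
      rw [List.getElem_drop]
      exact hw ⟨u.length + j, by simp at h; omega⟩
    have hne : w.drop u.length ≠ [] := by
      intro h0
      have := congrArg List.length h0
      simp at this
      omega
    refine ⟨w.drop u.length, ⟨⟨hne, ω, hω, u.length, fun i => hd i i.2⟩, ?_⟩, ?_⟩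
    · intro t ht
      refine ⟨by simp [hne], _, hX t ht, 0, ?_⟩
      rintro ⟨i, hi⟩
      simp only [wcat, List.get_eq_getElem, Nat.zero_add]
      split_ifs with hit
      · rw [List.getElem_append_left hit]
      · rw [List.getElem_append_right (by omega), hd]
    · have : w.take u.length = u := by
        apply List.ext_getElem
        · simp; omega
        · intro i h1 h2
          rw [List.getElem_take]
          exact (hw ⟨i, by omega⟩).trans (hpre ⟨i, h2⟩).symm
      conv_rhs => rw [← List.take_append_drop u.length w, this]
end

section
/- Let ω ∈ X and μ ∈ L_X. Then φ_ω(F_μ) = 1 — i.e., the set of nonempty finite prefixes p of ω with μp ∉ L_X is finite — if and only if μω ∈ X. -/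
open Set

variable {α : Type*}

/-- **Proposition (DescribeCharsAsWordsOnFollower).** Let `X` be a subshift over a finite
alphabet, `ω ∈ X` and `μ ∈ L_X`.  Then `φ_ω(F_μ) = 1` — that is, the set of nonempty
finite prefixes `p` of `ω` with `μp ∉ L_X` is finite (here `F_μ = {s ∈ L_X : μs ∈ L_X}`,
so that `σ_ω ∖ F_μ` is exactly that set) — if and only if `μω ∈ X`. -/
theorem stmt_7 {α : Type*} [Finite α] [TopologicalSpace α] [DiscreteTopology α]
    (X : Set (ℕ → α)) (hcl : IsClosed X) (hsh : ∀ x ∈ X, lshift x ∈ X)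
    (ω : ℕ → α) (hω : ω ∈ X) (μ : List α) (hμ : μ ∈ language X) :
    (infPrefixes ω \ {s | s ∈ language X ∧ μ ++ s ∈ language X}).Finite ↔
      wcat μ ω ∈ X := by
  have hshk : ∀ k : ℕ, ∀ x ∈ X, (fun n => x (k + n)) ∈ X := by
    intro k
    induction k with
    | zero => intro x hx; simpa using hx
    | succ k ih =>
      intro x hx
      have := ih _ (hsh x hx)
      convert this using 2 with n
      simp only [lshift]
      congr 1
      omega
  constructor
  · intro hfin
    have key : ∀ n : ℕ, ∃ y ∈ X, ∀ i < n, y i = wcat μ ω i := by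
      intro n
      obtain ⟨N, hN⟩ := (hfin.image List.length).bddAbove
      obtain ⟨m, hm⟩ : ∃ m, m = n + N + 1 := ⟨_, rfl⟩
      set p : List α := List.ofFn (fun i : Fin m => ω i) with hp
      have hpl : p.length = m := by simp [hp]
      have hpp : p ∈ infPrefixes ω := by
        refine ⟨?_, ?_⟩
        · intro h
          rw [h] at hpl
          simp at hpl
          omega
        · intro i
          simp [hp]
      have hl : μ ++ p ∈ language X := by
        by_contra hc
        have : p.length ≤ N := hN ⟨p, ⟨hpp, fun h => hc h.2⟩, rfl⟩
        omega
      obtain ⟨_, x, hx, k, hk⟩ := hl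
      refine ⟨_, hshk k x hx, ?_⟩
      intro i hi
      have hil : i < (μ ++ p).length := by rw [List.length_append]; omega
      have h1 := hk ⟨i, hil⟩
      simp only at h1 ⊢
      rw [← h1]
      unfold wcat
      split_ifs with h
      · simp [List.getElem_append, h]
      · simp [List.getElem_append, h, hp]
    choose y hy hyi using key
    refine hcl.mem_of_tendsto (f := y) (b := Filter.atTop) ?_ (Filter.Eventually.of_forall hy)
    rw [tendsto_pi_nhds]
    intro i
    apply tendsto_const_nhds.congr'
    filter_upwards [Filter.eventually_gt_atTop i] with n hn
    exact (hyi n i hn).symm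
  · intro h
    convert Set.finite_empty
    rw [Set.sdiff_eq_empty]
    rintro p ⟨hp0, hp⟩
    refine ⟨⟨hp0, ω, hω, 0, by simpa using hp⟩, by simp [hp0], _, h, 0, ?_⟩
    rintro ⟨i, hi⟩
    rw [List.length_append] at hi
    unfold wcat
    by_cases h : i < μ.length
    · simp [List.getElem_append, h]
    · have := hp ⟨i - μ.length, by omega⟩
      simp only [List.get_eq_getElem] at this
      simp [List.getElem_append, h, this]
end

section
/- Let μ ∈ L_X for the five-letter subshift X below. Then exactly one of the following holds: (a) F_μ equals the set of all words in L_X whose first letter is 1; (b) F_μ equals the set of all words in L_X whose first letter is 2; (c) F_μ contains every word in L_X whose first letter is 1 and every word in L_X whose first letter is 2. -/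
open Set

variable {α : Type*}

/-- The forbidden words: `1·0ⁿ·4·x` with `x ∈ {0,2,3,4}`, `2·0ⁿ·4·y` with
`y ∈ {0,1,3,4}`, and `3·0ⁿ·4`, for `n ≥ 1`. -/
def Forb : Set (List (Fin 5)) :=
  {w | ∃ n : ℕ, 1 ≤ n ∧
    ((∃ x : Fin 5, x ∈ ({0, 2, 3, 4} : Set (Fin 5)) ∧
        w = 1 :: (List.replicate n 0 ++ [4, x])) ∨
     (∃ y : Fin 5, y ∈ ({0, 1, 3, 4} : Set (Fin 5)) ∧
        w = 2 :: (List.replicate n 0 ++ [4, y])) ∨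
     w = 3 :: (List.replicate n 0 ++ [4]))}

/-- The subshift on `Σ = {0,1,2,3,4}` of all infinite words having no factor in `Forb`. -/
def X5 : Set (ℕ → Fin 5) := {ω | ∀ w ∈ Forb, ¬ OccursIn w ω}

/-- `F_μ = {s ∈ L_X : μs ∈ L_X}`. -/
def Fset (μ : List (Fin 5)) : Set (List (Fin 5)) :=
  {s | s ∈ language X5 ∧ μ ++ s ∈ language X5}

/-- The words of `L_X` whose first letter is `a`. -/
def startsWith (a : Fin 5) : Set (List (Fin 5)) :=
  {s | s ∈ language X5 ∧ s.head? = some a}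

def Occ (w : List α) (x : ℕ → α) (k : ℕ) : Prop :=
  ∀ i : Fin w.length, w.get i = x (k + (i : ℕ))

lemma Occ_iff (w : List α) (x : ℕ → α) (k : ℕ) :
    Occ w x k ↔ ∀ i (h : i < w.length), w[i] = x (k + i) :=
  ⟨fun H i h => H ⟨i, h⟩, fun H i => H i.1 i.2⟩

lemma Occ_nil (x : ℕ → α) (k : ℕ) : Occ [] x k := fun i => i.elim0

lemma Occ_cons (a : α) (w : List α) (x : ℕ → α) (k : ℕ) :
    Occ (a :: w) x k ↔ a = x k ∧ Occ w x (k + 1) := by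
  simp only [Occ_iff]
  constructor
  · intro H
    refine ⟨H 0 (Nat.succ_pos _), fun i h => ?_⟩
    have := H (i + 1) (by simpa using h)
    simp only [List.getElem_cons_succ] at this
    rw [this]; congr 1; omega
  · rintro ⟨h0, H⟩ i h
    cases i with
    | zero => simpa using h0
    | succ i =>
      simp only [List.getElem_cons_succ]
      rw [H i (by simpa using h)]; congr 1; omega

lemma Occ_append (u v : List α) (x : ℕ → α) (k : ℕ) :
    Occ (u ++ v) x k ↔ Occ u x k ∧ Occ v x (k + u.length) := by
  induction u generalizing k with
  | nil => simp [Occ_nil]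
  | cons a u ih =>
    rw [List.cons_append, Occ_cons, Occ_cons, ih, and_assoc, List.length_cons]
    rw [show k + 1 + u.length = k + (u.length + 1) by omega]

lemma Occ_replicate (n : ℕ) (a : α) (x : ℕ → α) (k : ℕ) :
    Occ (List.replicate n a) x k ↔ ∀ j < n, x (k + j) = a := by
  simp only [Occ_iff, List.length_replicate, List.getElem_replicate]
  exact ⟨fun H j h => (H j h).symm, fun H j h => (H j h).symm⟩

def Bad (x : ℕ → Fin 5) (k n : ℕ) : Prop :=
  1 ≤ n ∧ (∀ j < n, x (k + 1 + j) = 0) ∧ x (k + n + 1) = 4 ∧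
    ((x k = 1 ∧ x (k + n + 2) ≠ 1) ∨ (x k = 2 ∧ x (k + n + 2) ≠ 2) ∨ x k = 3)

lemma mem_X5 (x : ℕ → Fin 5) : x ∈ X5 ↔ ∀ k n, ¬ Bad x k n := by
  constructor
  · rintro H k n ⟨hn, h0, h4, h⟩
    have e1 : k + 1 + n = k + n + 1 := by omega
    rcases h with ⟨h1, h2⟩ | ⟨h1, h2⟩ | h1
    · refine H _ ⟨n, hn, Or.inl ⟨x (k + n + 2), ?_, rfl⟩⟩ ⟨k, ?_⟩
      · generalize x (k + n + 2) = t at h2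
        fin_cases t <;> simp_all
      · change Occ _ x k
        simp only [Occ_cons, Occ_append, Occ_replicate, List.length_replicate, e1]
        exact ⟨h1.symm, h0, h4.symm, trivial, Occ_nil _ _⟩
    · refine H _ ⟨n, hn, Or.inr (Or.inl ⟨x (k + n + 2), ?_, rfl⟩)⟩ ⟨k, ?_⟩
      · generalize x (k + n + 2) = t at h2
        fin_cases t <;> simp_all
      · change Occ _ x k
        simp only [Occ_cons, Occ_append, Occ_replicate, List.length_replicate, e1]
        exact ⟨h1.symm, h0, h4.symm, trivial, Occ_nil _ _⟩
    · refine H _ ⟨n, hn, Or.inr (Or.inr rfl)⟩ ⟨k, ?_⟩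
      change Occ _ x k
      simp only [Occ_cons, Occ_append, Occ_replicate, List.length_replicate, e1]
      exact ⟨h1.symm, h0, h4.symm, Occ_nil _ _⟩
  · rintro H w ⟨n, hn, h⟩ ⟨k, hk⟩
    change Occ w x k at hk
    have e1 : k + 1 + n = k + n + 1 := by omega
    rcases h with ⟨t, ht, rfl⟩ | ⟨t, ht, rfl⟩ | rfl
    · simp only [Occ_cons, Occ_append, Occ_replicate, List.length_replicate, e1] at hk
      obtain ⟨h1, h0, h4, h5, -⟩ := hk
      refine H k n ⟨hn, h0, h4.symm, Or.inl ⟨h1.symm, ?_⟩⟩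
      rw [show k + n + 2 = k + n + 1 + 1 from rfl, ← h5]
      rintro rfl; simp at ht
    · simp only [Occ_cons, Occ_append, Occ_replicate, List.length_replicate, e1] at hk
      obtain ⟨h1, h0, h4, h5, -⟩ := hk
      refine H k n ⟨hn, h0, h4.symm, Or.inr (Or.inl ⟨h1.symm, ?_⟩)⟩
      rw [show k + n + 2 = k + n + 1 + 1 from rfl, ← h5]
      rintro rfl; simp at ht
    · simp only [Occ_cons, Occ_append, Occ_replicate, List.length_replicate, e1] at hk
      obtain ⟨h1, h0, h4, -⟩ := hk
      exact H k n ⟨hn, h0, h4.symm, Or.inr (Or.inr h1.symm)⟩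

lemma shift_X5 (x : ℕ → Fin 5) (hx : x ∈ X5) (m : ℕ) : (fun i => x (m + i)) ∈ X5 := by
  rw [mem_X5] at *
  intro k n h
  apply hx (m + k) n
  simpa only [Bad, add_assoc] using h

lemma mem_lang (w : List (Fin 5)) :
    w ∈ language X5 ↔ w ≠ [] ∧ ∃ x ∈ X5, Occ w x 0 := by
  constructor
  · rintro ⟨h, x, hx, k, hk⟩
    exact ⟨h, _, shift_X5 x hx k, fun i => by simpa using hk i⟩
  · rintro ⟨h, x, hx, hk⟩
    exact ⟨h, x, hx, 0, hk⟩

def EE (x : ℕ → Fin 5) (L : ℕ) (b : Fin 5) : Prop :=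
  ∃ k n, 1 ≤ n ∧ L = k + n + 2 ∧ x k = b ∧ (∀ j < n, x (k + 1 + j) = 0) ∧ x (k + n + 1) = 4

lemma EE_excl (x : ℕ → Fin 5) (L : ℕ) (h1 : EE x L 1) (h2 : EE x L 2) : False := by
  obtain ⟨k, n, hn, hL, hk, h0, h4⟩ := h1
  obtain ⟨k', n', hn', hL', hk', h0', h4'⟩ := h2
  rcases lt_trichotomy k k' with h | h | h
  · have := h0 (k' - k - 1) (by omega)
    rw [show k + 1 + (k' - k - 1) = k' by omega, hk'] at this
    simp at this
  · subst h; rw [hk] at hk'; simp at hk'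
  · have := h0' (k - k' - 1) (by omega)
    rw [show k' + 1 + (k - k' - 1) = k by omega, hk] at this
    simp at this

lemma glue (x y z : ℕ → Fin 5) (hx : x ∈ X5) (hy : y ∈ X5) (L : ℕ)
    (hz1 : ∀ i < L, z i = x i) (hz2 : ∀ j, z (L + j) = y j)
    (a : Fin 5) (ha : a = 1 ∨ a = 2) (hya : y 0 = a)
    (hE1 : a ≠ 1 → ¬ EE x L 1) (hE2 : a ≠ 2 → ¬ EE x L 2) : z ∈ X5 := by
  rw [mem_X5] at *
  rintro k n hB
  have hzL : z L = a := by rw [← hya, ← hz2 0, add_zero]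
  rcases le_or_gt L k with h | h
  · obtain ⟨m, rfl⟩ := Nat.exists_eq_add_of_le h
    apply hy m n
    simpa only [Bad, add_assoc, hz2] using hB
  obtain ⟨hn, h0, h4, h5⟩ := hB
  have hL1 : k + n + 2 ≤ L := by
    by_contra hlt
    rcases Nat.lt_or_ge L (k + n + 1) with h6 | h6
    · have := h0 (L - k - 1) (by omega)
      rw [show k + 1 + (L - k - 1) = L by omega, hzL] at this
      rcases ha with rfl | rfl <;> simp at this
    · rw [show k + n + 1 = L by omega, hzL] at h4
      rcases ha with rfl | rfl <;> simp at h4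
  have x0 : ∀ j < n, x (k + 1 + j) = 0 := fun j hj => by
    rw [← hz1 _ (by omega)]; exact h0 j hj
  have x4 : x (k + n + 1) = 4 := by rw [← hz1 _ (by omega)]; exact h4
  have xk : z k = x k := hz1 k h
  rw [xk] at h5
  rcases hL1.lt_or_eq with h6 | h6
  · rw [hz1 _ h6] at h5
    exact hx k n ⟨hn, x0, x4, h5⟩
  · rw [h6, hzL] at h5
    rcases h5 with ⟨h7, h8⟩ | ⟨h7, h8⟩ | h7
    · exact hE1 h8 ⟨k, n, hn, h6.symm, h7, x0, x4⟩
    · exact hE2 h8 ⟨k, n, hn, h6.symm, h7, x0, x4⟩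
    · exact hx k n ⟨hn, x0, x4, Or.inr (Or.inr h7)⟩

lemma starts_sub (μ : List (Fin 5)) (x : ℕ → Fin 5) (hx : x ∈ X5) (hμ : Occ μ x 0)
    (a : Fin 5) (ha : a = 1 ∨ a = 2)
    (hE1 : a ≠ 1 → ¬ EE x μ.length 1) (hE2 : a ≠ 2 → ¬ EE x μ.length 2) :
    startsWith a ⊆ Fset μ := by
  rintro s ⟨hs, hh⟩
  refine ⟨hs, ?_⟩
  obtain ⟨hne, y, hy, hsy⟩ := (mem_lang s).1 hs
  rw [mem_lang]
  refine ⟨by simp [hne], fun i => if i < μ.length then x i else y (i - μ.length), ?_, ?_⟩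
  · refine glue x y _ hx hy μ.length (fun i hi => by simp [hi]) (fun j => by simp) a ha ?_ hE1 hE2
    cases s with
    | nil => simp at hh
    | cons b s =>
      rw [Occ_cons] at hsy
      simp at hh
      rw [← hsy.1, hh]
  · rw [Occ_append]
    rw [Occ_iff] at *
    rw [Occ_iff]
    constructor
    · intro i hi
      simpa [hi] using hμ i hi
    · intro i hi
      simpa using hsy i hi

lemma sub_starts (μ : List (Fin 5)) (x : ℕ → Fin 5) (hμ : Occ μ x 0)
    (a : Fin 5) (ha : a = 1 ∨ a = 2) (hE : EE x μ.length a) :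
    Fset μ ⊆ startsWith a := by
  rintro s ⟨hs, hms⟩
  refine ⟨hs, ?_⟩
  obtain ⟨-, z, hz, hmz⟩ := (mem_lang _).1 hms
  rw [Occ_append] at hmz
  obtain ⟨h1, h2⟩ := hmz
  obtain ⟨k, n, hn, hL, hk, h0, h4⟩ := hE
  have hzx : ∀ i < μ.length, z i = x i := fun i hi => by
    rw [Occ_iff] at h1 hμ
    have e1 := h1 i hi
    have e2 := hμ i hi
    rw [e1] at e2
    simpa using e2
  rw [mem_X5] at hz
  cases s with
  | nil => exact absurd rfl hs.1
  | cons b s =>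
    rw [Occ_cons] at h2
    have hb := h2.1
    rw [zero_add, hL] at hb
    simp only [List.head?_cons, Option.some.injEq]
    by_contra hne
    refine hz k n ⟨hn, fun j hj => ?_, ?_, ?_⟩
    · rw [hzx _ (by omega)]; exact h0 j hj
    · rw [hzx _ (by omega)]; exact h4
    · rw [← hb, hzx k (by omega), hk]
      rcases ha with rfl | rfl
      · exact Or.inl ⟨rfl, hne⟩
      · exact Or.inr (Or.inl ⟨rfl, hne⟩)

lemma single_mem (a : Fin 5) (ha : a = 1 ∨ a = 2) : [a] ∈ startsWith a := by
  refine ⟨(mem_lang _).2 ⟨by simp, fun _ => a, ?_, ?_⟩, rfl⟩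
  · rw [mem_X5]
    rintro k n ⟨_, _, h4, _⟩
    rcases ha with rfl | rfl <;> simp at h4
  · rw [Occ_cons]; exact ⟨rfl, Occ_nil _ _⟩

/-- **Proposition (DescribeFMu).** For every `μ ∈ L_X` in the five-letter subshift `X5`,
exactly one of the following holds:
(a) `F_μ` equals the set of words of `L_X` whose first letter is `1`;
(b) `F_μ` equals the set of words of `L_X` whose first letter is `2`;
(c) `F_μ` contains every word of `L_X` whose first letter is `1` and every word of
`L_X` whose first letter is `2`. -/
theorem stmt_10 (μ : List (Fin 5)) (hμ : μ ∈ language X5) :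
    (Fset μ = startsWith 1 ∧ ¬ Fset μ = startsWith 2 ∧
        ¬ (startsWith 1 ⊆ Fset μ ∧ startsWith 2 ⊆ Fset μ)) ∨
    (¬ Fset μ = startsWith 1 ∧ Fset μ = startsWith 2 ∧
        ¬ (startsWith 1 ⊆ Fset μ ∧ startsWith 2 ⊆ Fset μ)) ∨
    (¬ Fset μ = startsWith 1 ∧ ¬ Fset μ = startsWith 2 ∧
        (startsWith 1 ⊆ Fset μ ∧ startsWith 2 ⊆ Fset μ)) := by
  obtain ⟨-, x, hx, hm⟩ := (mem_lang μ).1 hμ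
  have m1 := single_mem 1 (Or.inl rfl)
  have m2 := single_mem 2 (Or.inr rfl)
  have n1 : [1] ∉ startsWith 2 := fun h => by simpa using h.2
  have n2 : [2] ∉ startsWith 1 := fun h => by simpa using h.2
  by_cases hE1 : EE x μ.length 1
  · have hE2 : ¬ EE x μ.length 2 := fun h => EE_excl x _ hE1 h
    have e : Fset μ = startsWith 1 :=
      (sub_starts μ x hm 1 (Or.inl rfl) hE1).antisymm
        (starts_sub μ x hx hm 1 (Or.inl rfl) (fun h => absurd rfl h) (fun _ => hE2))
    left
    rw [e]
    exact ⟨rfl, fun h => n1 (h ▸ m1), fun h => n2 (h.2 m2)⟩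
  by_cases hE2 : EE x μ.length 2
  · have e : Fset μ = startsWith 2 :=
      (sub_starts μ x hm 2 (Or.inr rfl) hE2).antisymm
        (starts_sub μ x hx hm 2 (Or.inr rfl) (fun _ => hE1) (fun h => absurd rfl h))
    right; left
    rw [e]
    exact ⟨fun h => n1 (h ▸ m1), rfl, fun h => n1 (h.1 m1)⟩
  · have s1 := starts_sub μ x hx hm 1 (Or.inl rfl) (fun _ => hE1) (fun _ => hE2)
    have s2 := starts_sub μ x hx hm 2 (Or.inr rfl) (fun _ => hE1) (fun _ => hE2)
    right; right
    exact ⟨fun h => n2 (h ▸ s2 m2), fun h => n1 (h ▸ s1 m1), s1, s2⟩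
end

section
/- In the five-letter subshift X below, the family Z = {E_1, E_2, E_3, E_4, 0F_{{10,20,30}}} is a cover for the constructible set F_{{1,2}}, and the defect set F_{{1,2}} ∖ (E_1 ∪ E_2 ∪ E_3 ∪ E_4 ∪ 0F_{{10,20,30}}) equals the set consisting of the five one-letter words 0, 1, 2, 3, 4 together with the words 0ⁿ4 for all n ≥ 1; in particular, there is a finite cover of an element of E(X) whose defect set is infinite. -/
open Set

variable {α : Type*}

/-- `E_a = {as : s ∈ L_X, as ∈ L_X}` for a letter `a`. -/
def Ea (a : Fin 5) : Set (List (Fin 5)) :=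
  {w | ∃ s : List (Fin 5), s ∈ language X5 ∧ a :: s ∈ language X5 ∧ w = a :: s}

/-- `0F_{{10,20,30}} = {0s : s ∈ L_X, 10s ∈ L_X, 20s ∈ L_X, 30s ∈ L_X}`. -/
def ZF : Set (List (Fin 5)) :=
  {w | ∃ s ∈ FLam X5 ({[1, 0], [2, 0], [3, 0]} : Finset (List (Fin 5))), w = 0 :: s}

/-- `F_{{1,2}} = {s ∈ L_X : 1s ∈ L_X and 2s ∈ L_X}`. -/
def F12 : Set (List (Fin 5)) := FLam X5 ({[1], [2]} : Finset (List (Fin 5)))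

def Good (w : List (Fin 5)) : Prop := ∀ f ∈ Forb, ¬ f <:+: w

def SS (c : Fin 5) (w : List (Fin 5)) : Prop :=
  ∃ n : ℕ, 1 ≤ n ∧ ∃ p, w = p ++ c :: (List.replicate n 0 ++ [4])

lemma uniq0 (n m : ℕ) (a b : Fin 5) (r r' : List (Fin 5)) (ha : a ≠ 0) (hb : b ≠ 0)
    (h : List.replicate n 0 ++ a :: r = List.replicate m 0 ++ b :: r') :
    n = m ∧ a = b ∧ r = r' := by
  induction n generalizing m with
  | zero =>
    cases m with
    | zero => simpa using h
    | succ m => simp [List.replicate_succ] at h; exact absurd h.1 ha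
  | succ n ih =>
    cases m with
    | zero => simp [List.replicate_succ] at h; exact absurd h.1.symm hb
    | succ m =>
      simp only [List.replicate_succ, List.cons_append, List.cons.injEq, true_and] at h
      obtain ⟨h1, h2⟩ := ih m h
      exact ⟨by omega, h2⟩

lemma SS_disj (w : List (Fin 5)) (h1 : SS 1 w) (h2 : SS 2 w) : False := by
  obtain ⟨n, _, p, rfl⟩ := h1
  obtain ⟨m, _, q, h⟩ := h2
  have h := congrArg List.reverse h
  simp only [List.reverse_append, List.reverse_cons, List.reverse_nil, List.nil_append,
    List.reverse_replicate, List.append_assoc, List.cons_append, List.cons.injEq, true_and] at h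
  have := uniq0 n m 1 2 _ _ (by decide) (by decide) h
  exact absurd this.2.1 (by decide)

lemma Good.mono {w v : List (Fin 5)} (h : Good w) (hv : v <:+: w) : Good v :=
  fun f hf hfv => h f hf (hfv.trans hv)

lemma good_nil : Good [] := by
  intro f hf h
  have : f = [] := List.infix_nil.mp h
  subst this
  obtain ⟨n, _, ⟨x, _, h⟩ | ⟨x, _, h⟩ | h⟩ := hf <;> simp at h

lemma good_snoc {w : List (Fin 5)} {b : Fin 5} (hw : Good w) (h1 : SS 1 w → b = 1)
    (h2 : SS 2 w → b = 2) (h4 : b ≠ 4) : Good (w ++ [b]) := by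
  intro f hf h
  rcases List.infix_concat_iff.mp h with h | h
  · obtain ⟨p, hp⟩ := h
    obtain ⟨n, hn, ⟨x, hx, rfl⟩ | ⟨x, hx, rfl⟩ | rfl⟩ := hf
    · have e : (p ++ 1 :: (List.replicate n 0 ++ [4])) ++ [x] = w ++ [b] := by
        rw [← hp]; simp
      obtain ⟨e1, e2⟩ := List.append_inj' e rfl
      have : x = b := by simpa using e2
      subst this
      rw [h1 ⟨n, hn, p, e1.symm⟩] at hx
      simp at hx
    · have e : (p ++ 2 :: (List.replicate n 0 ++ [4])) ++ [x] = w ++ [b] := by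
        rw [← hp]; simp
      obtain ⟨e1, e2⟩ := List.append_inj' e rfl
      have : x = b := by simpa using e2
      subst this
      rw [h2 ⟨n, hn, p, e1.symm⟩] at hx
      simp at hx
    · have e : (p ++ 3 :: (List.replicate n 0)) ++ [4] = w ++ [b] := by
        rw [← hp]; simp
      obtain ⟨e1, e2⟩ := List.append_inj' e rfl
      have : 4 = b := by simpa using e2
      exact h4 this.symm
  · exact hw f hf h

lemma good_snoc_S1 {w : List (Fin 5)} {b : Fin 5} (h : Good (w ++ [b])) (hs : SS 1 w) : b = 1 := by
  by_contra hb
  obtain ⟨n, hn, p, rfl⟩ := hs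
  refine h (1 :: (List.replicate n 0 ++ [4, b])) ⟨n, hn, Or.inl ⟨b, ?_, rfl⟩⟩ ⟨p, [], by simp⟩
  fin_cases b <;> simp_all

lemma good_snoc_S2 {w : List (Fin 5)} {b : Fin 5} (h : Good (w ++ [b])) (hs : SS 2 w) : b = 2 := by
  by_contra hb
  obtain ⟨n, hn, p, rfl⟩ := hs
  refine h (2 :: (List.replicate n 0 ++ [4, b])) ⟨n, hn, Or.inr (Or.inl ⟨b, ?_, rfl⟩)⟩
    ⟨p, [], by simp⟩
  fin_cases b <;> simp_all

lemma SS_last {c b : Fin 5} {w : List (Fin 5)} (h : SS c (w ++ [b])) : b = 4 := by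
  obtain ⟨n, hn, p, h⟩ := h
  have e : w ++ [b] = (p ++ c :: (List.replicate n 0)) ++ [4] := by rw [h]; simp
  simpa using (List.append_inj' e rfl).2

lemma good_rep {w : List (Fin 5)} {b : Fin 5} (h : Good (w ++ [b])) (h4 : b ≠ 4) (N : ℕ) :
    Good (w ++ List.replicate N b) := by
  have key : ∀ N, Good (w ++ List.replicate (N+1) b) := by
    intro N
    induction N with
    | zero => simpa using h
    | succ N ih =>
      rw [List.replicate_succ', ← List.append_assoc]
      have hl : ∀ c, ¬ SS c (w ++ List.replicate (N+1) b) := by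
        intro c hc
        rw [List.replicate_succ', ← List.append_assoc] at hc
        exact h4 (SS_last hc)
      exact good_snoc ih (fun h => absurd h (hl _)) (fun h => absurd h (hl _)) h4
  cases N with
  | zero => exact h.mono ⟨[], [b], by simp⟩
  | succ N => exact key N

lemma lang_iff (w : List (Fin 5)) : w ∈ language X5 ↔ w ≠ [] ∧ Good w := by
  constructor
  · rintro ⟨hw, x, hx, k, hk⟩
    refine ⟨hw, ?_⟩
    rintro f hf ⟨a, b, rfl⟩
    refine hx f hf ⟨k + a.length, ?_⟩
    intro i
    have := hk ⟨a.length + i, by have := i.2; simp; omega⟩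
    simp only [List.get_eq_getElem] at this ⊢
    rw [add_assoc, ← this, List.getElem_append_left (by have := i.2; simp),
      List.getElem_append_right (by simp)]
    simp
  · rintro ⟨hw, hg⟩
    obtain ⟨c, hc⟩ : ∃ c : Fin 5, ∀ N, Good (w ++ List.replicate N c) := by
      by_cases h2 : SS 2 w
      · exact ⟨2, good_rep (good_snoc hg (fun h => (SS_disj w h h2).elim) (fun _ => rfl)
          (by decide)) (by decide)⟩
      · exact ⟨1, good_rep (good_snoc hg (fun _ => rfl) (fun h => absurd h h2)
          (by decide)) (by decide)⟩
    refine ⟨hw, fun n => if h : n < w.length then w[n] else c, ?_, 0, ?_⟩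
    · rintro f hf ⟨k, hk⟩
      refine hc (k + f.length) f hf ?_
      have : f = ((w ++ List.replicate (k + f.length) c).drop k).take f.length := by
        apply List.ext_getElem
        · simp; omega
        · intro i h1 h2
          have := hk ⟨i, h1⟩
          simp only [List.get_eq_getElem] at this
          rw [this]
          simp [List.getElem_append]
      have h2 := (List.take_prefix f.length
        ((w ++ List.replicate (k + f.length) c).drop k)).isInfix.trans
        (List.drop_suffix _ _).isInfix
      rwa [← this] at h2
    · intro i
      simp

/-- prefix obstruction -/
lemma good_cons {w : List (Fin 5)} {a : Fin 5} (hw : Good w)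
    (h : ∀ n r, 1 ≤ n → w = List.replicate n 0 ++ 4 :: r →
      (a ≠ 3 ∧ ∀ x r', r = x :: r' → a ≠ 1 ∧ a ≠ 2)) : Good (a :: w) := by
  intro f hf hi
  rcases List.infix_cons_iff.mp hi with hp | hp
  · obtain ⟨r, hr⟩ := hp
    obtain ⟨n, hn, ⟨x, hx, rfl⟩ | ⟨x, hx, rfl⟩ | rfl⟩ := hf
    · simp only [List.cons_append, List.cons.injEq, List.append_assoc] at hr
      exact ((h n (x :: r) hn (by rw [← hr.2]; simp)).2 x r rfl).1 hr.1.symm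
    · simp only [List.cons_append, List.cons.injEq, List.append_assoc] at hr
      exact ((h n (x :: r) hn (by rw [← hr.2]; simp)).2 x r rfl).2 hr.1.symm
    · simp only [List.cons_append, List.cons.injEq, List.append_assoc] at hr
      exact ((h n r hn (by rw [← hr.2]; simp)).1) hr.1.symm
  · exact hw f hf hp

lemma good_cons_ne {w : List (Fin 5)} {a b : Fin 5} (hb : b ≠ 0) (hw : Good (b :: w)) :
    Good (a :: b :: w) := by
  apply good_cons hw
  intro n r hn e
  obtain ⟨m, rfl⟩ : ∃ m, n = m + 1 := ⟨n - 1, by omega⟩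
  simp [List.replicate_succ] at e
  exact absurd e.1 hb

lemma good_single (a : Fin 5) : Good [a] := by
  apply good_cons good_nil
  intro n r hn e
  simp at e

lemma good_pair (a b : Fin 5) : Good [a, b] := by
  apply good_cons (good_single b)
  intro n r hn e
  obtain ⟨m, rfl⟩ : ∃ m, n = m + 1 := ⟨n - 1, by omega⟩
  simp [List.replicate_succ] at e

lemma good_z4 (n : ℕ) : Good (List.replicate n 0 ++ [4]) := by
  induction n with
  | zero => exact good_single 4
  | succ n ih =>
    rw [List.replicate_succ, List.cons_append]
    apply good_cons ih
    intro n r hn e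
    simp

lemma good_cz4 (c : Fin 5) (hc : c ≠ 3) (n : ℕ) : Good (c :: (List.replicate n 0 ++ [4])) := by
  apply good_cons (good_z4 n)
  intro m r hm e
  refine ⟨hc, ?_⟩
  rintro x r' rfl
  have := uniq0 n m 4 4 _ _ (by decide) (by decide) e
  simp at this

lemma mem_F12 (w : List (Fin 5)) :
    w ∈ F12 ↔ w ≠ [] ∧ Good (1 :: w) ∧ Good (2 :: w) := by
  simp only [F12, FLam, Set.mem_setOf_eq, lang_iff, Finset.mem_insert, Finset.mem_singleton,
    forall_eq_or_imp, forall_eq]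
  constructor
  · rintro ⟨⟨h, _⟩, ⟨_, h1⟩, ⟨_, h2⟩⟩
    exact ⟨h, h1, h2⟩
  · rintro ⟨h, h1, h2⟩
    exact ⟨⟨h, h1.mono ⟨[1], [], by simp⟩⟩, ⟨by simp, h1⟩, ⟨by simp, h2⟩⟩

lemma mem_Ea (a : Fin 5) (w : List (Fin 5)) :
    w ∈ Ea a ↔ ∃ s, s ≠ [] ∧ Good (a :: s) ∧ w = a :: s := by
  simp only [Ea, Set.mem_setOf_eq, lang_iff]
  constructor
  · rintro ⟨s, h1, h2, h3⟩
    exact ⟨s, h1.1, h2.2, h3⟩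
  · rintro ⟨s, h1, h2, h3⟩
    exact ⟨s, ⟨h1, h2.mono ⟨[a], [], by simp⟩⟩, ⟨by simp, h2⟩, h3⟩

lemma mem_ZF (w : List (Fin 5)) :
    w ∈ ZF ↔ ∃ s, s ≠ [] ∧ Good (1 :: 0 :: s) ∧ Good (2 :: 0 :: s) ∧ Good (3 :: 0 :: s)
      ∧ w = 0 :: s := by
  simp only [ZF, FLam, Set.mem_setOf_eq, lang_iff, Finset.mem_insert, Finset.mem_singleton,
    forall_eq_or_imp, forall_eq]
  constructor
  · rintro ⟨s, ⟨⟨h, _⟩, ⟨_, h1⟩, ⟨_, h2⟩, ⟨_, h3⟩⟩, rfl⟩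
    exact ⟨s, h, h1, h2, h3, rfl⟩
  · rintro ⟨s, h, h1, h2, h3, rfl⟩
    exact ⟨s, ⟨⟨h, h1.mono ⟨[1, 0], [], by simp⟩⟩, ⟨by simp, h1⟩, ⟨by simp, h2⟩,
      ⟨by simp, h3⟩⟩, rfl⟩

lemma Ea_sub (a : Fin 5) (ha : a ≠ 0) : Ea a ⊆ F12 := by
  intro w hw
  obtain ⟨s, hs, hg, rfl⟩ := (mem_Ea a w).mp hw
  exact (mem_F12 _).mpr ⟨by simp, good_cons_ne ha hg, good_cons_ne ha hg⟩

lemma ZF_sub : ZF ⊆ F12 := by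
  intro w hw
  obtain ⟨s, hs, h1, h2, h3, rfl⟩ := (mem_ZF w).mp hw
  exact (mem_F12 _).mpr ⟨by simp, h1, h2⟩

lemma Ea_con (a : Fin 5) : Constructible X5 (Ea a) := by
  refine Or.inr ⟨{[a]}, [a], ?_, ⟨[a], by simp, ?_⟩, by simp, ?_⟩
  · intro t ht
    rw [Finset.mem_singleton] at ht
    subst ht
    exact Or.inr ((lang_iff _).mpr ⟨by simp, good_single a⟩)
  · exact (lang_iff _).mpr ⟨by simp, good_single a⟩
  · ext w
    simp only [Ea, FLam, Set.mem_setOf_eq, Set.mem_image, Finset.mem_singleton, forall_eq]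
    constructor
    · rintro ⟨s, h1, h2, rfl⟩
      exact ⟨s, ⟨h1, h2⟩, rfl⟩
    · rintro ⟨s, ⟨h1, h2⟩, rfl⟩
      exact ⟨s, h1, h2, rfl⟩

lemma F12_con : Constructible X5 F12 := by
  refine Or.inr ⟨{[], [1], [2]}, [], ?_, ⟨[1], by simp, ?_⟩, by simp, ?_⟩
  · intro t ht
    simp only [Finset.mem_insert, Finset.mem_singleton] at ht
    rcases ht with rfl | rfl | rfl
    · exact Or.inl rfl
    · exact Or.inr ((lang_iff _).mpr ⟨by simp, good_single _⟩)
    · exact Or.inr ((lang_iff _).mpr ⟨by simp, good_single _⟩)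
  · exact (lang_iff _).mpr ⟨by simp, good_single _⟩
  · ext w
    simp [F12, FLam]

lemma ZF_con : Constructible X5 ZF := by
  refine Or.inr ⟨{[0], [1, 0], [2, 0], [3, 0]}, [0], ?_, ⟨[0], by simp, ?_⟩, by simp, ?_⟩
  · intro t ht
    simp only [Finset.mem_insert, Finset.mem_singleton] at ht
    rcases ht with rfl | rfl | rfl | rfl
    · exact Or.inr ((lang_iff _).mpr ⟨by simp, good_single _⟩)
    all_goals exact Or.inr ((lang_iff _).mpr ⟨by simp, good_pair _ _⟩)
  · exact (lang_iff _).mpr ⟨by simp, good_single _⟩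
  · ext w
    rw [mem_ZF]
    simp only [FLam, Set.mem_setOf_eq, Set.mem_image, lang_iff, Finset.mem_insert,
      Finset.mem_singleton, forall_eq_or_imp, forall_eq]
    constructor
    · rintro ⟨s, h, h1, h2, h3, rfl⟩
      exact ⟨s, ⟨⟨h, h1.mono ⟨[1, 0], [], by simp⟩⟩, ⟨by simp, h1.mono ⟨[1], [], by simp⟩⟩,
        ⟨by simp, h1⟩, ⟨by simp, h2⟩, ⟨by simp, h3⟩⟩, rfl⟩
    · rintro ⟨s, ⟨⟨h, _⟩, _, ⟨_, h1⟩, ⟨_, h2⟩, ⟨_, h3⟩⟩, rfl⟩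
      exact ⟨s, h, h1, h2, h3, rfl⟩

lemma lemD (s : List (Fin 5)) (hs : s ≠ []) (h : 0 :: s ∈ F12) :
    0 :: s ∈ ZF ∨ ∃ n, 1 ≤ n ∧ 0 :: s = List.replicate n 0 ++ [4] := by
  obtain ⟨_, h1, h2⟩ := (mem_F12 _).mp h
  by_cases h3 : ∃ n r, 1 ≤ n ∧ 0 :: s = List.replicate n 0 ++ 4 :: r
  · right
    obtain ⟨n, r, hn, e⟩ := h3
    cases r with
    | nil => exact ⟨n, hn, e⟩
    | cons x r =>
      exfalso
      rw [e] at h1 h2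
      have a1 : x = 1 := good_snoc_S1 (w := 1 :: (List.replicate n 0 ++ [4]))
        (h1.mono ⟨[], r, by simp⟩) ⟨n, hn, [], rfl⟩
      have a2 : x = 2 := good_snoc_S2 (w := 2 :: (List.replicate n 0 ++ [4]))
        (h2.mono ⟨[], r, by simp⟩) ⟨n, hn, [], rfl⟩
      rw [a1] at a2
      exact absurd a2 (by decide)
  · left
    refine (mem_ZF _).mpr ⟨s, hs, h1, h2, ?_, rfl⟩
    apply good_cons (h1.mono ⟨[1], [], by simp⟩)
    intro n r hn e
    exact absurd ⟨n, r, hn, e⟩ h3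

lemma class_F12 (w : List (Fin 5)) (h : w ∈ F12) :
    (∃ a, w = [a]) ∨ (w ∈ Ea 1 ∨ w ∈ Ea 2 ∨ w ∈ Ea 3 ∨ w ∈ Ea 4 ∨ w ∈ ZF) ∨
      ∃ n, 1 ≤ n ∧ w = List.replicate n 0 ++ [4] := by
  have h' := (mem_F12 _).mp h
  match w, h, h' with
  | [], _, h' => exact absurd rfl h'.1
  | [a], _, _ => exact Or.inl ⟨a, rfl⟩
  | a :: b :: s, h, h' =>
    right
    by_cases ha : a = 0
    · subst ha
      rcases lemD _ (by simp) h with h | h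
      · exact Or.inl (by tauto)
      · exact Or.inr h
    · left
      have : a :: b :: s ∈ Ea a :=
        (mem_Ea _ _).mpr ⟨_, by simp, h'.2.1.mono ⟨[1], [], by simp⟩, rfl⟩
      fin_cases a
      · exact absurd rfl ha
      all_goals (simp at this ⊢; tauto)

lemma rep3 {t : List (Fin 5)} {b : Fin 5} (h : Good (t ++ [b])) (h1 : b ≠ 1) (h2 : b ≠ 2) :
    Good (t ++ [3]) :=
  good_snoc (h.mono ⟨[], [b], by simp⟩) (fun hs => absurd (good_snoc_S1 h hs) h1)
    (fun hs => absurd (good_snoc_S2 h hs) h2) (by decide)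

lemma cover (C : Set (List (Fin 5))) (hC : Constructible X5 C) (hs : C ⊆ F12)
    (hn : C.Nonempty) :
      (C ∩ Ea 1).Nonempty ∨ (C ∩ Ea 2).Nonempty ∨ (C ∩ Ea 3).Nonempty ∨
      (C ∩ Ea 4).Nonempty ∨ (C ∩ ZF).Nonempty := by
  have fin : ∀ w ∈ C, (w ∈ Ea 1 ∨ w ∈ Ea 2 ∨ w ∈ Ea 3 ∨ w ∈ Ea 4 ∨ w ∈ ZF) →
      (C ∩ Ea 1).Nonempty ∨ (C ∩ Ea 2).Nonempty ∨ (C ∩ Ea 3).Nonempty ∨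
      (C ∩ Ea 4).Nonempty ∨ (C ∩ ZF).Nonempty := by
    intro w hw h
    rcases h with h | h | h | h | h
    · exact Or.inl ⟨w, hw, h⟩
    · exact Or.inr (Or.inl ⟨w, hw, h⟩)
    · exact Or.inr (Or.inr (Or.inl ⟨w, hw, h⟩))
    · exact Or.inr (Or.inr (Or.inr (Or.inl ⟨w, hw, h⟩)))
    · exact Or.inr (Or.inr (Or.inr (Or.inr ⟨w, hw, h⟩)))
  rcases hC with rfl | ⟨Λ, u, hΛ, -, hu, rfl⟩
  · exact absurd hn (by simp)
  obtain ⟨w, s, hsF, rfl⟩ := hn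
  have hgood : ∀ s' : List (Fin 5), s' ≠ [] → (∀ t ∈ Λ, Good (t ++ s')) → s' ∈ FLam X5 Λ := by
    intro s' h0 h
    refine ⟨(lang_iff _).mpr ⟨h0, (h u hu).mono ⟨u, [], by simp⟩⟩, fun t ht => ?_⟩
    exact (lang_iff _).mpr ⟨by simp [h0], h t ht⟩
  obtain ⟨hsL, hst⟩ := hsF
  have hs0 := ((lang_iff _).mp hsL).1
  obtain ⟨b, s, rfl⟩ := List.exists_cons_of_ne_nil hs0
  have hb : ∀ t ∈ Λ, Good (t ++ [b]) := fun t ht =>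
    ((lang_iff _).mp (hst t ht)).2.mono ⟨[], s, by simp⟩
  by_cases hu0 : u = []
  · subst hu0
    obtain ⟨c, hc, hcg⟩ : ∃ c : Fin 5, (c = 1 ∨ c = 2 ∨ c = 3) ∧ ∀ t ∈ Λ, Good (t ++ [c]) := by
      by_cases h1 : b = 1
      · exact ⟨b, by tauto, hb⟩
      by_cases h2 : b = 2
      · exact ⟨b, by tauto, hb⟩
      exact ⟨3, by tauto, fun t ht => rep3 (hb t ht) h1 h2⟩
    have hc4 : c ≠ 4 := by rcases hc with rfl | rfl | rfl <;> decide
    have hm : [c, c] ∈ FLam X5 Λ := hgood _ (by simp) fun t ht => good_rep (hcg t ht) hc4 2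
    have hE : [c, c] ∈ Ea c := (mem_Ea _ _).mpr ⟨[c], by simp, good_pair _ _, rfl⟩
    refine fin [c, c] ⟨_, hm, rfl⟩ ?_
    rcases hc with rfl | rfl | rfl <;> tauto
  · have hw : u ++ b :: s ∈ (fun s => u ++ s) '' FLam X5 Λ := ⟨_, ⟨hsL, hst⟩, rfl⟩
    rcases class_F12 _ (hs hw) with ⟨a, ha⟩ | h | ⟨n, hn, h⟩
    · have e1 := congrArg List.length ha
      have e2 := List.length_pos_iff.mpr hu0
      simp only [List.length_append, List.length_cons, List.length_nil] at e1
      omega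
    · exact fin _ hw h
    · have hbm : b ∈ List.replicate n (0 : Fin 5) ++ [4] := by rw [← h]; simp
      have hb' : b = 0 ∨ b = 4 := by
        simp only [List.mem_append, List.mem_replicate, List.mem_singleton] at hbm
        tauto
      have hm : [3] ∈ FLam X5 Λ := hgood _ (by simp) fun t ht =>
        rep3 (hb t ht) (by rcases hb' with rfl | rfl <;> decide)
          (by rcases hb' with rfl | rfl <;> decide)
      have hw3 : u ++ [3] ∈ (fun s => u ++ s) '' FLam X5 Λ := ⟨_, hm, rfl⟩
      rcases class_F12 _ (hs hw3) with ⟨a, ha⟩ | h | ⟨n, hn, h⟩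
      · have e1 := congrArg List.length ha
        have e2 := List.length_pos_iff.mpr hu0
        simp only [List.length_append, List.length_cons, List.length_nil] at e1
        omega
      · exact fin _ hw3 h
      · have := (List.append_inj' h rfl).2
        simp at this

lemma bad_z4 (n : ℕ) (hn : 1 ≤ n) : ¬ Good (3 :: (List.replicate n 0 ++ [4])) := fun h =>
  h _ ⟨n, hn, Or.inr (Or.inr rfl)⟩ (List.infix_refl _)

lemma defect : F12 \ (Ea 1 ∪ Ea 2 ∪ Ea 3 ∪ Ea 4 ∪ ZF) =
      ({[0], [1], [2], [3], [4]} : Set (List (Fin 5))) ∪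
        {w | ∃ n : ℕ, 1 ≤ n ∧ w = List.replicate n 0 ++ [4]} := by
  ext w
  simp only [Set.mem_diff, Set.mem_union, Set.mem_setOf_eq, Set.mem_insert_iff,
    Set.mem_singleton_iff]
  constructor
  · rintro ⟨h, hn⟩
    rcases class_F12 w h with ⟨a, rfl⟩ | h | h
    · left
      fin_cases a <;> simp
    · tauto
    · exact Or.inr h
  · rintro (h | ⟨n, hn, rfl⟩)
    · obtain ⟨a, rfl⟩ : ∃ a, w = [a] := by
        rcases h with h | h | h | h | h <;> exact ⟨_, h⟩
      refine ⟨(mem_F12 _).mpr ⟨by simp, good_pair _ _, good_pair _ _⟩, ?_⟩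
      simp only [mem_Ea, mem_ZF]
      rintro ((((⟨s, h0, _, h⟩ | ⟨s, h0, _, h⟩) | ⟨s, h0, _, h⟩) | ⟨s, h0, _, h⟩) |
        ⟨s, h0, _, _, _, h⟩) <;> simp at h <;> exact h0 h.2
    · refine ⟨(mem_F12 _).mpr ⟨by simp, good_cz4 _ (by decide) _, good_cz4 _ (by decide) _⟩, ?_⟩
      have hbad := bad_z4 n hn
      obtain ⟨m, rfl⟩ : ∃ m, n = m + 1 := ⟨n - 1, by omega⟩
      simp only [mem_Ea, mem_ZF]
      rintro ((((⟨s, h0, _, h⟩ | ⟨s, h0, _, h⟩) | ⟨s, h0, _, h⟩) | ⟨s, h0, _, h⟩) |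
        ⟨s, h0, _, _, h3, h⟩)
      · simp [List.replicate_succ] at h
      · simp [List.replicate_succ] at h
      · simp [List.replicate_succ] at h
      · simp [List.replicate_succ] at h
      · rw [← h] at h3
        exact hbad h3

/-- **(Section `CounterExEssTight`).** In the five-letter subshift `X5`, the family
`Z = {E_1, E_2, E_3, E_4, 0F_{{10,20,30}}}` is a cover for the constructible set
`F_{{1,2}}` (its members are constructible subsets of `F_{{1,2}}` and every nonempty
constructible subset of `F_{{1,2}}` meets one of them), and the defect set
`F_{{1,2}} ∖ (E_1 ∪ E_2 ∪ E_3 ∪ E_4 ∪ 0F_{{10,20,30}})` equals the set consisting of the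
five one-letter words `0,1,2,3,4` together with the words `0ⁿ4`, `n ≥ 1`.  In particular,
there is a finite cover of an element of `E(X)` whose defect set is infinite. -/
theorem stmt_11 :
    ((Constructible X5 (Ea 1) ∧ Ea 1 ⊆ F12) ∧
     (Constructible X5 (Ea 2) ∧ Ea 2 ⊆ F12) ∧
     (Constructible X5 (Ea 3) ∧ Ea 3 ⊆ F12) ∧
     (Constructible X5 (Ea 4) ∧ Ea 4 ⊆ F12) ∧
     (Constructible X5 ZF ∧ ZF ⊆ F12)) ∧
    (∀ C : Set (List (Fin 5)), Constructible X5 C → C ⊆ F12 → C.Nonempty →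
      (C ∩ Ea 1).Nonempty ∨ (C ∩ Ea 2).Nonempty ∨ (C ∩ Ea 3).Nonempty ∨
      (C ∩ Ea 4).Nonempty ∨ (C ∩ ZF).Nonempty) ∧
    (F12 \ (Ea 1 ∪ Ea 2 ∪ Ea 3 ∪ Ea 4 ∪ ZF) =
      ({[0], [1], [2], [3], [4]} : Set (List (Fin 5))) ∪
        {w | ∃ n : ℕ, 1 ≤ n ∧ w = List.replicate n 0 ++ [4]}) ∧
    (∃ (A : Set (List (Fin 5))) (n : ℕ) (Z : Fin n → Set (List (Fin 5))),
      Constructible X5 A ∧ (∀ i, Constructible X5 (Z i) ∧ Z i ⊆ A) ∧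
      (∀ C : Set (List (Fin 5)), Constructible X5 C → C ⊆ A → C.Nonempty →
        ∃ i, (C ∩ Z i).Nonempty) ∧
      (A \ ⋃ i, Z i).Infinite) := by
  refine ⟨⟨⟨Ea_con 1, Ea_sub 1 (by decide)⟩, ⟨Ea_con 2, Ea_sub 2 (by decide)⟩,
    ⟨Ea_con 3, Ea_sub 3 (by decide)⟩, ⟨Ea_con 4, Ea_sub 4 (by decide)⟩, ⟨ZF_con, ZF_sub⟩⟩,
    cover, defect, F12, 5, ![Ea 1, Ea 2, Ea 3, Ea 4, ZF], F12_con, ?_, ?_, ?_⟩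
  · intro i
    fin_cases i
    · exact ⟨Ea_con 1, Ea_sub 1 (by decide)⟩
    · exact ⟨Ea_con 2, Ea_sub 2 (by decide)⟩
    · exact ⟨Ea_con 3, Ea_sub 3 (by decide)⟩
    · exact ⟨Ea_con 4, Ea_sub 4 (by decide)⟩
    · exact ⟨ZF_con, ZF_sub⟩
  · intro C h1 h2 h3
    rcases cover C h1 h2 h3 with h | h | h | h | h
    · exact ⟨0, h⟩
    · exact ⟨1, h⟩
    · exact ⟨2, h⟩
    · exact ⟨3, h⟩
    · exact ⟨4, h⟩
  · have hU : (⋃ i, (![Ea 1, Ea 2, Ea 3, Ea 4, ZF] : Fin 5 → Set (List (Fin 5))) i) =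
        Ea 1 ∪ Ea 2 ∪ Ea 3 ∪ Ea 4 ∪ ZF := by
      ext w
      simp only [Set.mem_iUnion, Fin.exists_fin_succ, Set.mem_union]
      simp
      tauto
    rw [hU, defect]
    refine Set.Infinite.mono Set.subset_union_right ?_
    refine Set.infinite_of_injective_forall_mem
      (f := fun n : ℕ => List.replicate (n + 1) (0 : Fin 5) ++ [4]) ?_ ?_
    · intro a b h
      have := congrArg List.length h
      simpa using this
    · intro n
      exact ⟨n + 1, by omega, rfl⟩
end

section
/- Let Ω be a set and let E be a family of subsets of Ω containing ∅ and closed under finite intersections. Then the essentially tight characters on E form a closed subset of the space of all characters on E in the topology of pointwise convergence. -/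
open Set

variable {Ω : Type*}

/-- A character on a family `E` of subsets of `Ω` containing `∅` and closed under finite
intersections: a `{0,1}`-valued map vanishing at `∅`, multiplicative, not identically
zero. -/
def IsCharacterOn (E : Set (Set Ω)) (φ : E → Bool) : Prop :=
  (∀ A : E, (A : Set Ω) = ∅ → φ A = false) ∧
  (∀ A B C : E, (C : Set Ω) = (A : Set Ω) ∩ (B : Set Ω) → φ C = (φ A && φ B)) ∧
  (∃ A : E, φ A = true)

/-- An essentially tight character: `φ(A) = max φ(Bᵢ)` whenever the symmetric difference
`A Δ (B₁ ∪ … ∪ B_n)` is finite. -/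
def IsEssTightOn (E : Set (Set Ω)) (φ : E → Bool) : Prop :=
  ∀ (A : E) (n : ℕ) (B : Fin n → E),
    (symmDiff (A : Set Ω) (⋃ i, (B i : Set Ω))).Finite →
    (φ A = true ↔ ∃ i, φ (B i) = true)

/-- **Proposition (SessClosed).** Let `Ω` be a set and `E` a family of subsets of `Ω`
containing `∅` and closed under finite intersections.  Then the essentially tight
characters on `E` form a closed subset of the space of all characters on `E`, in the
topology of pointwise convergence. -/
theorem stmt_12 (E : Set (Set Ω)) (h0 : (∅ : Set Ω) ∈ E)
    (hinter : ∀ A ∈ E, ∀ B ∈ E, A ∩ B ∈ E) :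
    IsClosed {φ : {f : E → Bool // IsCharacterOn E f} | IsEssTightOn E φ.1} := by
  have hc : ∀ A : E, IsClopen {φ : {f : E → Bool // IsCharacterOn E f} | φ.1 A = true} := by
    intro A
    have hcont : Continuous (fun φ : {f : E → Bool // IsCharacterOn E f} => φ.1 A) :=
      (continuous_apply A).comp continuous_subtype_val
    exact (isClopen_discrete ({true} : Set Bool)).preimage hcont
  simp only [IsEssTightOn, setOf_forall]
  refine isClosed_iInter fun A => isClosed_iInter fun n => isClosed_iInter fun B =>
    isClosed_iInter fun _ => ?_
  have hB : IsClopen {φ : {f : E → Bool // IsCharacterOn E f} | ∃ i, φ.1 (B i) = true} := by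
    rw [setOf_exists]
    exact isClopen_iUnion_of_finite fun i => hc (B i)
  simp only [iff_iff_implies_and_implies, setOf_and]
  exact (isClosed_imp (hc A).isOpen hB.isClosed).inter (isClosed_imp hB.isOpen (hc A).isClosed)
end

section
/- Let X be a subshift on a finite alphabet Σ. The following are equivalent: (i) X satisfies Carlsen–Matsumoto's condition (*); (ii) the set Ê_ess of essentially tight characters on E(X) coincides with the closure of Ê_max := {φ_ω : ω ∈ X} in the space of characters on E(X) with the topology of pointwise convergence. -/
open Set

variable {α : Type*}

/-- The type of constructible subsets of `L_X`. -/
abbrev ConstrSet (X : Set (ℕ → α)) := {A : Set (List α) // Constructible X A}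

/-- The space of characters on `E(X)`, with the topology of pointwise convergence
(inherited from the product topology on `ConstrSet X → Bool`). -/
abbrev CharSp (X : Set (ℕ → α)) :=
  {φ : ConstrSet X → Bool //
    (∀ A : ConstrSet X, (A : Set (List α)) = ∅ → φ A = false) ∧
    (∀ A B C : ConstrSet X,
      (C : Set (List α)) = (A : Set (List α)) ∩ (B : Set (List α)) →
      φ C = (φ A && φ B)) ∧
    (∃ A : ConstrSet X, φ A = true)}

section Aux

open Filter

/-- prefix -/
def pfx (ω : ℕ → α) (n : ℕ) : List α := List.ofFn (fun i : Fin n => ω i)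

lemma pfx_length (ω : ℕ → α) (n : ℕ) : (pfx ω n).length = n := by simp [pfx]

lemma pfx_get (ω : ℕ → α) (n i : ℕ) (h : i < (pfx ω n).length) : (pfx ω n)[i] = ω i := by simp [pfx]

lemma pfx_inj (ω : ℕ → α) : Function.Injective (pfx ω) := fun a b h => by
  have := congrArg List.length h
  simpa [pfx_length] using this

lemma pfx_wcat (t : List α) (ω : ℕ → α) (m : ℕ) :
    pfx (wcat t ω) (t.length + m) = t ++ pfx ω m := by
  apply List.ext_getElem
  · simp [pfx_length]
  · intro i h1 h2
    rw [pfx_get, List.getElem_append]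
    simp only [wcat]
    split <;> simp_all [pfx_get]

lemma wcat_append (t u : List α) (ω : ℕ → α) : wcat t (wcat u ω) = wcat (t ++ u) ω := by
  funext n
  simp only [wcat, List.get_eq_getElem, List.getElem_append, List.length_append]
  split_ifs <;> first | rfl | omega | (congr 1; omega)

lemma wcat_pfx (ω : ℕ → α) (n : ℕ) : wcat (pfx ω n) (fun k => ω (n + k)) = ω := by
  funext k
  simp only [wcat, List.get_eq_getElem, pfx_get, pfx_length]
  split_ifs
  · rfl
  · congr 1; omega

lemma wcat_nil (ω : ℕ → α) : wcat [] ω = ω := by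
  funext k; simp [wcat]

lemma lang_infix {X : Set (ℕ → α)} {w a b : List α} (h : a ++ w ++ b ∈ language X)
    (hw : w ≠ []) : w ∈ language X := by
  obtain ⟨-, x, hx, k, hk⟩ := h
  refine ⟨hw, x, hx, k + a.length, fun i => ?_⟩
  have := hk ⟨a.length + i, by simp; omega⟩
  simp only [List.get_eq_getElem] at this ⊢
  rw [add_assoc, ← this, List.getElem_append_left (by simp), List.getElem_append_right (by omega)]
  simp

lemma lang_prefix {X : Set (ℕ → α)} {w b : List α} (h : w ++ b ∈ language X)
    (hw : w ≠ []) : w ∈ language X := lang_infix (a := []) (b := b) (by simpa using h) hw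

lemma lang_suffix {X : Set (ℕ → α)} {w b : List α} (h : b ++ w ∈ language X)
    (hw : w ≠ []) : w ∈ language X := lang_infix (a := b) (b := []) (by simpa using h) hw

lemma shift_mem {X : Set (ℕ → α)} (hsh : ∀ x ∈ X, lshift x ∈ X) {x : ℕ → α} (hx : x ∈ X) (k : ℕ) :
    (fun n => x (k + n)) ∈ X := by
  induction k with
  | zero => simpa using hx
  | succ k ih =>
    have := hsh _ ih
    convert this using 1
    funext n
    simp only [lshift]; congr 1; omega

lemma wcat_tail {X : Set (ℕ → α)} (hsh : ∀ x ∈ X, lshift x ∈ X) {t : List α} {ω : ℕ → α}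
    (h : wcat t ω ∈ X) : ω ∈ X := by
  convert shift_mem hsh h t.length using 1
  funext n; simp [wcat]

lemma pfx_mem_lang {X : Set (ℕ → α)} {ω : ℕ → α} (h : ω ∈ X) {n : ℕ} (hn : n ≠ 0) :
    pfx ω n ∈ language X := by
  refine ⟨fun h => hn ?_, ω, h, 0, fun i => ?_⟩
  · rw [← pfx_length ω n, h]; rfl
  · simp [pfx_get]

lemma mem_of_freq [TopologicalSpace α] [DiscreteTopology α] {X : Set (ℕ → α)} (hcl : IsClosed X)
    (hsh : ∀ x ∈ X, lshift x ∈ X) {ω : ℕ → α} (h : ∃ᶠ n in atTop, pfx ω n ∈ language X) :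
    ω ∈ X := by
  rw [← hcl.closure_eq, mem_closure_iff]
  intro U hU hω
  obtain ⟨I, u, hu, hsub⟩ := isOpen_pi_iff.1 hU ω hω
  obtain ⟨n, hn, -, x, hx, k, hk⟩ := frequently_atTop.1 h (I.sup id + 1)
  refine ⟨_, hsub ?_, shift_mem hsh hx k⟩
  intro i hi
  have h1 : i ≤ I.sup id := Finset.le_sup (f := id) hi
  have := hk ⟨i, by rw [pfx_length]; omega⟩
  simp only [List.get_eq_getElem, pfx_get] at this
  show x (k + i) ∈ u i
  rw [← this]
  exact (hu i hi).2

lemma app_mem {X : Set (ℕ → α)} {t : List α} {ω : ℕ → α} (h : wcat t ω ∈ X) {n : ℕ} (hn : n ≠ 0) :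
    t ++ pfx ω n ∈ language X := by
  rw [← pfx_wcat]; exact pfx_mem_lang h (by omega)

lemma wcat_of_freq [TopologicalSpace α] [DiscreteTopology α] {X : Set (ℕ → α)} (hcl : IsClosed X)
    (hsh : ∀ x ∈ X, lshift x ∈ X) {t : List α} {ω : ℕ → α}
    (h : ∃ᶠ n in atTop, t ++ pfx ω n ∈ language X) :
    wcat t ω ∈ X := by
  apply mem_of_freq hcl hsh
  rw [frequently_atTop] at h ⊢
  intro a
  obtain ⟨b, hb, h⟩ := h a
  exact ⟨t.length + b, by omega, by rwa [pfx_wcat]⟩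

lemma finite_iff (ω : ℕ → α) (A : Set (List α)) :
    (infPrefixes ω \ A).Finite ↔ ∀ᶠ n in atTop, pfx ω n ∈ A := by
  have h1 : infPrefixes ω \ A = pfx ω '' {n | n ≠ 0 ∧ pfx ω n ∉ A} := by
    ext w
    constructor
    · rintro ⟨⟨h1, h2⟩, h3⟩
      have : pfx ω w.length = w := by
        apply List.ext_getElem
        · simp [pfx_length]
        · intro i _ hi
          rw [pfx_get]; exact (h2 ⟨i, hi⟩).symm
      exact ⟨w.length, ⟨by simpa using h1, by rwa [this]⟩, this⟩
    · rintro ⟨n, ⟨h1, h2⟩, rfl⟩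
      refine ⟨⟨fun h => h1 ?_, fun i => by simp [pfx_get]⟩, h2⟩
      rw [← pfx_length ω n, h]; rfl
  rw [h1, Set.finite_image_iff (pfx_inj ω).injOn, ← Nat.cofinite_eq_atTop, eventually_cofinite]
  constructor
  · intro h
    refine (h.insert 0).subset fun n hn => ?_
    by_cases h0 : n = 0
    · simp [h0]
    · exact Or.inr ⟨h0, hn⟩
  · intro h
    exact h.subset fun n hn => hn.2

lemma ev_wcat [TopologicalSpace α] [DiscreteTopology α] {X : Set (ℕ → α)} (hcl : IsClosed X)
    (hsh : ∀ x ∈ X, lshift x ∈ X) (u : List α) (Λ : Finset (List α)) (hu : u ∈ Λ) (ω : ℕ → α) :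
    (∀ᶠ n in atTop, pfx (wcat u ω) n ∈ (fun s => u ++ s) '' FLam X Λ) ↔
      ∀ t ∈ Λ, wcat t ω ∈ X := by
  constructor
  · intro h t ht
    apply wcat_of_freq hcl hsh
    apply Eventually.frequently
    have h2 := (tendsto_add_atTop_nat u.length).eventually h
    filter_upwards [h2] with n hn
    rw [add_comm, pfx_wcat] at hn
    obtain ⟨s, hs, he⟩ := hn
    rw [← List.append_cancel_left he]
    exact hs.2 t ht
  · intro h
    filter_upwards [eventually_gt_atTop u.length] with n hn
    obtain ⟨m, rfl⟩ := Nat.exists_eq_add_of_lt hn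
    rw [add_assoc, pfx_wcat]
    refine ⟨_, ⟨pfx_mem_lang (wcat_tail hsh (h u hu)) (by omega), fun t ht => ?_⟩, rfl⟩
    exact app_mem (h t ht) (by omega)

lemma pfx_prefix {ω : ℕ → α} {n : ℕ} {u s : List α} (h : u ++ s = pfx ω n) :
    ∃ ω', ω = wcat u ω' := by
  refine ⟨wcat s (fun k => ω (n + k)), ?_⟩
  rw [wcat_append, h, wcat_pfx]

lemma flam_prefix {X : Set (ℕ → α)} {Λ : Finset (List α)} {s b : List α} (h : s ++ b ∈ FLam X Λ)
    (hs : s ≠ []) : s ∈ FLam X Λ :=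
  ⟨lang_prefix h.1 hs, fun t ht => lang_prefix (b := b) (by simpa using h.2 t ht) (by simp [hs])⟩

lemma dich {X : Set (ℕ → α)} {A : Set (List α)} (hA : Constructible X A) {ω : ℕ → α}
    (h : ∃ᶠ n in atTop, pfx ω n ∈ A) : ∀ᶠ n in atTop, pfx ω n ∈ A := by
  rcases hA with rfl | ⟨Λ, u, -, -, hu, rfl⟩
  · simp at h
  obtain ⟨n, s, hs, he⟩ := h.exists
  obtain ⟨ω', rfl⟩ := pfx_prefix he
  filter_upwards [eventually_gt_atTop u.length] with k hk
  obtain ⟨m, rfl⟩ := Nat.exists_eq_add_of_lt hk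
  obtain ⟨l, hl, s', hs', he'⟩ := frequently_atTop.1 h (u.length + m + 1)
  obtain ⟨j, rfl⟩ := Nat.exists_eq_add_of_le hl
  have e : pfx ω' (m + 1 + j) = pfx ω' (m+1) ++ pfx (fun i => ω' (m + 1 + i)) j := by
    conv_lhs => rw [← wcat_pfx ω' (m+1)]
    have := pfx_wcat (pfx ω' (m+1)) (fun i => ω' (m + 1 + i)) j
    rwa [pfx_length] at this
  rw [show u.length + m + 1 + j = u.length + (m+1+j) by omega, pfx_wcat, e] at he'
  rw [List.append_cancel_left he'] at hs'
  rw [add_assoc, pfx_wcat]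
  refine ⟨_, flam_prefix hs' ?_, rfl⟩
  intro h0
  have := congrArg List.length h0
  simp [pfx_length] at this

open Classical in
/-- character of a filter -/
noncomputable def mkChar (X : Set (ℕ → α)) (F : Filter (List α)) [F.NeBot]
    (h : ∃ A, Constructible X A ∧ A ∈ F) : CharSp X :=
  ⟨fun A => decide (A.1 ∈ F), fun A hA => by simp [hA],
    fun A B C hC => by simp [hC],
    by obtain ⟨A, hA, h⟩ := h; exact ⟨⟨A, hA⟩, by simpa using h⟩⟩

lemma mkChar_iff {X : Set (ℕ → α)} (F : Filter (List α)) [F.NeBot]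
    (h : ∃ A, Constructible X A ∧ A ∈ F) (A : ConstrSet X) : (mkChar X F h).1 A = true ↔ A.1 ∈ F := by
  simp [mkChar]

lemma ess_of {X : Set (ℕ → α)} (F : Filter (List α)) [F.NeBot] (hF : F ≤ cofinite)
    (hd : ∀ A : ConstrSet X, (∃ᶠ w in F, w ∈ A.1) → A.1 ∈ F)
    (A : ConstrSet X) (n : ℕ) (B : Fin n → ConstrSet X)
    (h : (symmDiff (A : Set (List α)) (⋃ i, (B i : Set (List α)))).Finite) :
    A.1 ∈ F ↔ ∃ i, (B i).1 ∈ F := by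
  have h1 : ∀ᶠ w in F, w ∈ A.1 ↔ ∃ i, w ∈ (B i).1 := by
    filter_upwards [hF h.compl_mem_cofinite] with w hw
    simp only [Set.mem_compl_iff, Set.mem_symmDiff, Set.mem_iUnion] at hw
    tauto
  constructor
  · intro hA
    by_contra hc
    push Not at hc
    have h2 : ∀ᶠ w in F, ∀ i, w ∉ (B i).1 := by
      rw [eventually_all]
      intro i
      by_contra h3
      exact hc i (hd _ h3)
    have hA' : ∀ᶠ w in F, w ∈ A.1 := hA
    obtain ⟨w, a, b, c⟩ := (hA'.and (h1.and h2)).exists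
    obtain ⟨i, hi⟩ := b.1 a
    exact c i hi
  · rintro ⟨i, hi⟩
    filter_upwards [h1, hi] with w a b
    exact a.2 ⟨i, b⟩

lemma char_closure {X : Set (ℕ → α)} (S : Set (CharSp X)) (φ : CharSp X) :
    φ ∈ closure S ↔ ∀ I : Finset (ConstrSet X), ∃ ψ ∈ S, ∀ A ∈ I, ψ.1 A = φ.1 A := by
  rw [mem_closure_iff]
  constructor
  · intro h I
    obtain ⟨ψ, h1, h2⟩ := h {ψ | ∀ A ∈ I, ψ.1 A = φ.1 A} (by
      have : {ψ : CharSp X | ∀ A ∈ I, ψ.1 A = φ.1 A} =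
        ⋂ A ∈ I, (fun ψ : CharSp X => ψ.1 A) ⁻¹' {φ.1 A} := by ext; simp
      rw [this]
      refine isOpen_biInter_finset fun A _ => ?_
      exact (isOpen_discrete _).preimage ((continuous_apply A).comp continuous_subtype_val))
      (fun _ _ => rfl)
    exact ⟨ψ, h2, h1⟩
  · rintro h o ho hφ
    obtain ⟨V, hV, rfl⟩ := isOpen_induced_iff.1 ho
    obtain ⟨I, u, hu, hsub⟩ := isOpen_pi_iff.1 hV φ.1 hφ
    obtain ⟨ψ, h1, h2⟩ := h I
    refine ⟨ψ, hsub ?_, h1⟩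
    intro A hA
    rw [h2 A hA]
    exact (hu A hA).2

lemma constr_inter_aux {X : Set (ℕ → α)} (Λ Δ : Finset (List α)) (u w : List α)
    (h1 : ∀ t ∈ Λ, t = [] ∨ t ∈ language X)
    (k1 : ∀ t ∈ Δ, t = [] ∨ t ∈ language X) (k2 : ∃ t ∈ Δ, t ∈ language X) (h3 : u ∈ Λ)
    (k3 : u ++ w ∈ Δ) :
    Constructible X (((fun s => u ++ s) '' FLam X Λ) ∩ ((fun s => (u ++ w) ++ s) '' FLam X Δ)) := by
  classical
  by_cases hc : ∀ t ∈ Λ, t ++ w = [] ∨ t ++ w ∈ language X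
  · right
    refine ⟨Λ.image (· ++ w) ∪ Δ, u ++ w, ?_, ?_, by simp [k3], ?_⟩
    · intro t ht
      rcases Finset.mem_union.1 ht with ht | ht
      · obtain ⟨t, ht', rfl⟩ := Finset.mem_image.1 ht
        exact hc t ht'
      · exact k1 t ht
    · obtain ⟨t, ht, h⟩ := k2
      exact ⟨t, by simp [ht], h⟩
    · ext x
      constructor
      · rintro ⟨⟨s, hs, rfl⟩, s', hs', he⟩
        simp only [List.append_assoc] at he
        have := List.append_cancel_left he
        subst this
        refine ⟨s', ⟨hs'.1, fun t ht => ?_⟩, by simp⟩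
        rcases Finset.mem_union.1 ht with ht | ht
        · obtain ⟨t, ht', rfl⟩ := Finset.mem_image.1 ht
          simpa using hs.2 t ht'
        · exact hs'.2 t ht
      · rintro ⟨s, hs, rfl⟩
        have h5 : ∀ t ∈ Λ, t ++ (w ++ s) ∈ language X := fun t ht => by
          have := hs.2 (t ++ w) (by simp only [Finset.mem_union, Finset.mem_image]; exact Or.inl ⟨t, ht, rfl⟩)
          simpa using this
        refine ⟨⟨w ++ s, ⟨lang_suffix (h5 u h3) (by simp [hs.1.1]), h5⟩, by simp⟩,
          s, ⟨hs.1, fun t ht => hs.2 t (by simp [ht])⟩, rfl⟩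
  · left
    push Not at hc
    obtain ⟨t, ht, h4, h5⟩ := hc
    rw [Set.eq_empty_iff_forall_notMem]
    rintro x ⟨⟨s, hs, rfl⟩, s', hs', he⟩
    simp only [List.append_assoc] at he
    have := List.append_cancel_left he
    subst this
    exact h5 (lang_prefix (b := s') (by simpa using hs.2 t ht) h4)

lemma constr_inter {X : Set (ℕ → α)} {A B : Set (List α)} (hA : Constructible X A)
    (hB : Constructible X B) : Constructible X (A ∩ B) := by
  rcases hA with rfl | ⟨Λ, u, h1, h2, h3, rfl⟩
  · left; simp
  rcases hB with rfl | ⟨Δ, v, k1, k2, k3, rfl⟩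
  · left; simp
  by_cases huv : u <+: v
  · obtain ⟨w, rfl⟩ := huv
    exact constr_inter_aux Λ Δ u w h1 k1 k2 h3 k3
  by_cases hvu : v <+: u
  · obtain ⟨w, rfl⟩ := hvu
    rw [Set.inter_comm]
    exact constr_inter_aux Δ Λ v w k1 h1 h2 k3 h3
  left
  rw [Set.eq_empty_iff_forall_notMem]
  rintro x ⟨⟨s, hs, rfl⟩, s', hs', he⟩
  have he' : v <+: u ++ s := ⟨s', he⟩
  rcases List.prefix_or_prefix_of_prefix (List.prefix_append u s) he' with h | h
  · exact huv h
  · exact hvu h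

lemma exists_uf {S : Set (List α)} (h : S.Infinite) :
    ∃ U : Ultrafilter (List α), (U : Filter (List α)) ≤ cofinite ∧ S ∈ U := by
  have : (cofinite ⊓ 𝓟 S : Filter (List α)).NeBot := h.cofinite_inf_principal_neBot
  refine ⟨Ultrafilter.of (cofinite ⊓ 𝓟 S), (Ultrafilter.of_le _).trans inf_le_left, ?_⟩
  exact (Ultrafilter.of_le _).trans inf_le_right (mem_principal_self S)

lemma uf_prefix [Finite α] (U : Ultrafilter (List α)) (hU : (U : Filter (List α)) ≤ cofinite)
    (N : ℕ) : ∃ p : List α, p.length = N ∧ ∀ᶠ w in (U : Filter (List α)), ∃ s, s ≠ [] ∧ w = p ++ s := by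
  have h1 : ∀ᶠ w in (U : Filter (List α)), ∃ p ∈ {p : List α | p.length = N},
      ∃ s, s ≠ [] ∧ w = p ++ s := by
    filter_upwards [hU (List.finite_length_le α N).compl_mem_cofinite] with w hw
    simp only [Set.mem_compl_iff, Set.mem_ofPred_eq, not_le] at hw
    exact ⟨w.take N, by simp; omega, w.drop N, by simp; omega, by simp⟩
  exact (Ultrafilter.eventually_exists_mem_iff (List.finite_length_eq α N)).1 h1

lemma core [Finite α] [TopologicalSpace α] [DiscreteTopology α] {X : Set (ℕ → α)}
    (hcl : IsClosed X) (hsh : ∀ x ∈ X, lshift x ∈ X)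
    (hi : ∀ Λ Γ : Finset (List α),
        (∀ t ∈ Λ, t = [] ∨ t ∈ language X) → (∀ r ∈ Γ, r = [] ∨ r ∈ language X) →
        {s | s ∈ language X ∧ (∀ t ∈ Λ, t ++ s ∈ language X) ∧
            (∀ r ∈ Γ, r ++ s ∉ language X)}.Infinite →
        ∃ ω ∈ X, (∀ t ∈ Λ, wcat t ω ∈ X) ∧ (∀ r ∈ Γ, wcat r ω ∉ X))
    (A : ConstrSet X) (N : Finset (ConstrSet X)) (hinf : (A.1 \ ⋃ B ∈ N, B.1).Infinite) :
    ∃ ω ∈ X, (∀ᶠ n in atTop, pfx ω n ∈ A.1) ∧ ∀ B ∈ N, ¬ ∀ᶠ n in atTop, pfx ω n ∈ B.1 := by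
  classical
  obtain ⟨A, hA⟩ := A
  rcases hA with rfl | ⟨Λ, u, h1, h2, h3, rfl⟩
  · simp at hinf
  have hN : ∃ M, u.length ≤ M ∧ ∀ B ∈ N, B.1 = ∅ ∨ ∃ (Δ : Finset (List α)) (v : List α),
      v ∈ Δ ∧ v.length ≤ M ∧ B.1 = (fun s => v ++ s) '' FLam X Δ := by
    have : ∀ B : ConstrSet X, ∃ M, B.1 = ∅ ∨ ∃ (Δ : Finset (List α)) (v : List α),
      v ∈ Δ ∧ v.length ≤ M ∧ B.1 = (fun s => v ++ s) '' FLam X Δ := by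
      rintro ⟨B, h | ⟨Δ, v, -, -, k3, h⟩⟩
      · exact ⟨0, Or.inl h⟩
      · exact ⟨v.length, Or.inr ⟨Δ, v, k3, le_rfl, h⟩⟩
    choose f hf using this
    refine ⟨u.length + N.sup f, by omega, fun B hB => ?_⟩
    rcases hf B with h | ⟨Δ, v, k3, k4, h⟩
    · exact Or.inl h
    · have := Finset.le_sup (f := f) hB
      exact Or.inr ⟨Δ, v, k3, by omega, h⟩
  obtain ⟨M, hM, hN⟩ := hN
  obtain ⟨U, hU, hS⟩ := exists_uf hinf
  obtain ⟨p, hp, hev⟩ := uf_prefix U hU M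
  have hS' : ∀ᶠ w in (U : Filter (List α)), w ∈ ((fun s => u ++ s) '' FLam X Λ) \ ⋃ B ∈ N, B.1 := hS
  have hup : u <+: p := by
    obtain ⟨w, ⟨s, -, rfl⟩, ⟨s', -, hs'⟩, -⟩ := (hev.and hS').exists
    exact List.prefix_of_prefix_length_le ⟨s', hs'⟩ (List.prefix_append p s) (by omega)
  obtain ⟨w, rfl⟩ := hup
  have hG : ∀ B ∈ N, ∃ Γ : Finset (List α), (∀ r ∈ Γ, (r = [] ∨ r ∈ language X) ∧
      ∀ᶠ x in (U : Filter (List α)), r ++ x.drop M ∉ language X) ∧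
      ∀ ω, (∀ r ∈ Γ, wcat r ω ∉ X) → ¬ ∀ᶠ n in atTop, pfx (wcat (u ++ w) ω) n ∈ B.1 := by
    intro B hB
    rcases hN B hB with h | ⟨Δ, v, k3, k4, h⟩
    · exact ⟨∅, by simp, fun ω _ hc => by obtain ⟨n, hn⟩ := hc.exists; simp [h] at hn⟩
    by_cases hv : v <+: u ++ w
    · obtain ⟨z, hz⟩ := hv
      have e1 : ∀ᶠ x in (U : Filter (List α)), ∃ r ∈ (Δ : Set (List α)),
          (r ++ z) ++ x.drop M ∉ language X := by
        filter_upwards [hev, hS'] with x hx1 hx2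
        obtain ⟨s, hs, rfl⟩ := hx1
        by_contra hc
        push Not at hc
        rw [List.drop_left' hp] at hc
        apply hx2.2
        simp only [Set.mem_iUnion]
        refine ⟨B, hB, ?_⟩
        rw [h]
        refine ⟨z ++ s, ⟨?_, fun t ht => by simpa using hc t ht⟩, ?_⟩
        · have := hc v k3
          exact lang_suffix (b := v) (by simpa using this) (by simp [hs])
        · show v ++ (z ++ s) = _
          rw [← List.append_assoc, hz]
      obtain ⟨r, hr, e2⟩ := (Ultrafilter.eventually_exists_mem_iff Δ.finite_toSet).1 e1
      have key : ∀ ω, wcat (r ++ z) ω ∉ X → ¬ ∀ᶠ n in atTop, pfx (wcat (u ++ w) ω) n ∈ B.1 := by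
        intro ω hω hc
        rw [← hz, h, ← wcat_append, ev_wcat hcl hsh v Δ k3] at hc
        have := hc r hr
        rw [wcat_append] at this
        exact hω this
      by_cases hq : r ++ z = [] ∨ r ++ z ∈ language X
      · refine ⟨{r ++ z}, ?_, fun ω hω => key ω (hω _ (by simp))⟩
        intro q hq'
        rw [Finset.mem_singleton] at hq'
        subst hq'
        exact ⟨hq, e2⟩
      · refine ⟨∅, by simp, fun ω _ => key ω fun hc => hq ?_⟩
        push Not at hq
        exact Or.inr (lang_prefix (app_mem hc one_ne_zero) hq.1)
    · refine ⟨∅, by simp, fun ω _ hc => hv ?_⟩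
      obtain ⟨n, hn1, hn2⟩ := (hc.and (eventually_ge_atTop M)).exists
      rw [h] at hn1
      obtain ⟨s, -, hs⟩ := hn1
      obtain ⟨j, rfl⟩ := Nat.exists_eq_add_of_le hn2
      rw [← hp, pfx_wcat] at hs
      exact List.prefix_of_prefix_length_le ⟨s, hs⟩ (List.prefix_append _ _) (by omega)
  choose! Γ hΓ1 hΓ2 using hG
  have hfin : ∀ᶠ x in (U : Filter (List α)), x.drop M ∈ {s | s ∈ language X ∧
      (∀ t ∈ Λ.image (· ++ w), t ++ s ∈ language X) ∧
            (∀ r ∈ N.biUnion Γ, r ++ s ∉ language X)} := by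
    have e3 : ∀ᶠ x in (U : Filter (List α)), ∀ r ∈ N.biUnion Γ, r ++ x.drop M ∉ language X := by
      rw [Filter.eventually_all_finset]
      intro r hr
      obtain ⟨B, hB, hr⟩ := Finset.mem_biUnion.1 hr
      exact (hΓ1 B hB r hr).2
    filter_upwards [e3, hev, hS'] with x h3x h1x h2x
    obtain ⟨s, hs, rfl⟩ := h1x
    rw [List.drop_left' hp] at h3x ⊢
    obtain ⟨⟨s', hs', he⟩, -⟩ := h2x
    simp only [List.append_assoc] at he
    have := List.append_cancel_left he
    subst this
    refine ⟨lang_suffix hs'.1 hs, fun t ht => ?_, h3x⟩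
    obtain ⟨t, ht', rfl⟩ := Finset.mem_image.1 ht
    simpa using hs'.2 t ht'
  have hinf' : {s | s ∈ language X ∧ (∀ t ∈ Λ.image (· ++ w), t ++ s ∈ language X) ∧
            (∀ r ∈ N.biUnion Γ, r ++ s ∉ language X)}.Infinite := by
    intro hf
    have hf2 : ∀ᶠ x in (U : Filter (List α)), x ∉ (fun s => (u ++ w) ++ s) '' _ :=
      hU (hf.image (fun s => (u ++ w) ++ s)).compl_mem_cofinite
    obtain ⟨x, ⟨hx1, s, -, rfl⟩, hx2⟩ := ((hfin.and hev).and hf2).exists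
    rw [List.drop_left' hp] at hx1
    exact hx2 ⟨s, hx1, rfl⟩
  have o1 : ∀ t ∈ Λ.image (· ++ w), t = [] ∨ t ∈ language X := by
    intro t ht
    obtain ⟨x, hx⟩ := hfin.exists
    by_cases h0 : t = []
    · exact Or.inl h0
    · exact Or.inr (lang_prefix (hx.2.1 t ht) h0)
  have o2 : ∀ r ∈ N.biUnion Γ, r = [] ∨ r ∈ language X := by
    intro r hr
    obtain ⟨B, hB, hr⟩ := Finset.mem_biUnion.1 hr
    exact (hΓ1 B hB r hr).1
  obtain ⟨ω, hω, hω1, hω2⟩ := hi (Λ.image (· ++ w)) (N.biUnion Γ) o1 o2 hinf'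
  · have hL : ∀ t ∈ Λ, wcat t (wcat w ω) ∈ X := fun t ht => by
      rw [wcat_append]
      exact hω1 _ (Finset.mem_image_of_mem (· ++ w) ht)
    refine ⟨wcat (u ++ w) ω, ?_, ?_, ?_⟩
    · rw [← wcat_append]; exact hL u h3
    · rw [← wcat_append]
      exact (ev_wcat hcl hsh u Λ h3 _).2 hL
    · intro B hB
      exact hΓ2 B hB ω fun r hr => hω2 r (Finset.mem_biUnion.2 ⟨B, hB, hr⟩)

lemma ev_exists [TopologicalSpace α] [DiscreteTopology α] {X : Set (ℕ → α)}
    (hcl : IsClosed X) (hsh : ∀ x ∈ X, lshift x ∈ X) {ω : ℕ → α} (hω : ω ∈ X) :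
    ∃ A, Constructible X A ∧ A ∈ Filter.map (pfx ω) atTop := by
  refine ⟨_, Or.inr ⟨{pfx ω 1}, pfx ω 1, ?_, ?_, by simp, rfl⟩, ?_⟩
  · intro t ht
    rw [Finset.mem_singleton] at ht
    subst ht
    exact Or.inr (pfx_mem_lang hω one_ne_zero)
  · exact ⟨_, by simp, pfx_mem_lang hω one_ne_zero⟩
  · have := (ev_wcat hcl hsh (pfx ω 1) {pfx ω 1} (by simp) (fun k => ω (1 + k))).2 (by
      intro t ht
      rw [Finset.mem_singleton] at ht
      subst ht
      rwa [wcat_pfx])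
    rw [wcat_pfx] at this
    exact this

lemma closure_sub (X : Set (ℕ → α)) : closure {φ : CharSp X |
          ∃ ω ∈ X, ∀ A : ConstrSet X,
            (φ.1 A = true ↔ (infPrefixes ω \ (A : Set (List α))).Finite)} ⊆
    {φ : CharSp X |
          ∀ (A : ConstrSet X) (n : ℕ) (B : Fin n → ConstrSet X),
            (symmDiff (A : Set (List α)) (⋃ i, (B i : Set (List α)))).Finite →
            (φ.1 A = true ↔ ∃ i, φ.1 (B i) = true)} := by
  classical
  intro φ hφ A n B h
  rw [char_closure] at hφ
  obtain ⟨ψ, ⟨ω, hω, h1⟩, h2⟩ := hφ (insert A (Finset.univ.image B))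
  rw [← h2 A (by simp)]
  have h3 : ∀ i, φ.1 (B i) = ψ.1 (B i) := fun i => (h2 (B i) (by simp)).symm
  simp only [h3, h1, finite_iff]
  refine ess_of (Filter.map (pfx ω) atTop) ?_ (fun A hA => dich A.2 hA) A n B h
  rw [← Nat.cofinite_eq_atTop]
  exact (pfx_inj ω).tendsto_cofinite

end Aux

/-- **Proposition (CMConditionForSX).** Let `X` be a subshift on a finite alphabet.
The following are equivalent:
(i) `X` satisfies Carlsen–Matsumoto's condition `(*)`: whenever `Λ, Γ` are finite sets
of words (each empty or in `L_X`) such that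
`F_{Λ,Γ} = {s ∈ L_X : ts ∈ L_X ∀ t ∈ Λ, rs ∉ L_X ∀ r ∈ Γ}` is infinite, there is
`ω ∈ X` with `tω ∈ X` for all `t ∈ Λ` and `rω ∉ X` for all `r ∈ Γ`;
(ii) the set `Ê_ess` of essentially tight characters on `E(X)` coincides with the
closure of `Ê_max = {φ_ω : ω ∈ X}` in the space of characters. -/
theorem stmt_14 {α : Type*} [Finite α] [TopologicalSpace α] [DiscreteTopology α]
    (X : Set (ℕ → α)) (hcl : IsClosed X) (hsh : ∀ x ∈ X, lshift x ∈ X) :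
    (∀ Λ Γ : Finset (List α),
        (∀ t ∈ Λ, t = [] ∨ t ∈ language X) → (∀ r ∈ Γ, r = [] ∨ r ∈ language X) →
        {s | s ∈ language X ∧ (∀ t ∈ Λ, t ++ s ∈ language X) ∧
            (∀ r ∈ Γ, r ++ s ∉ language X)}.Infinite →
        ∃ ω ∈ X, (∀ t ∈ Λ, wcat t ω ∈ X) ∧ (∀ r ∈ Γ, wcat r ω ∉ X)) ↔
      {φ : CharSp X |
          ∀ (A : ConstrSet X) (n : ℕ) (B : Fin n → ConstrSet X),
            (symmDiff (A : Set (List α)) (⋃ i, (B i : Set (List α)))).Finite →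
            (φ.1 A = true ↔ ∃ i, φ.1 (B i) = true)} =
        closure {φ : CharSp X |
          ∃ ω ∈ X, ∀ A : ConstrSet X,
            (φ.1 A = true ↔ (infPrefixes ω \ (A : Set (List α))).Finite)} := by
  classical
  constructor
  · intro hi
    apply Set.Subset.antisymm
    · intro φ hφ
      have hφ : ∀ (A : ConstrSet X) (n : ℕ) (B : Fin n → ConstrSet X),
            (symmDiff (A : Set (List α)) (⋃ i, (B i : Set (List α)))).Finite →
            (φ.1 A = true ↔ ∃ i, φ.1 (B i) = true) := hφ
      rw [char_closure]
      intro I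
      have hP : ∀ P : Finset (ConstrSet X), (∀ A ∈ P, φ.1 A = true) →
          ∃ A : ConstrSet X, φ.1 A = true ∧ ∀ B ∈ P, A.1 ⊆ B.1 := by
        intro P
        induction P using Finset.induction_on with
        | empty =>
          intro _
          obtain ⟨A, hA⟩ := φ.2.2.2
          exact ⟨A, hA, by simp⟩
        | insert C P _ ih =>
          intro h
          obtain ⟨A, hA, hA2⟩ := ih fun A hA => h A (by simp [hA])
          refine ⟨⟨A.1 ∩ C.1, constr_inter A.2 C.2⟩, ?_, ?_⟩
          · rw [φ.2.2.1 A C _ rfl, hA, h C (by simp)]; rfl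
          · intro B hB
            rcases Finset.mem_insert.1 hB with rfl | hB
            · exact Set.inter_subset_right
            · exact Set.inter_subset_left.trans (hA2 B hB)
      obtain ⟨A, hA, hA2⟩ := hP (I.filter fun A => φ.1 A = true) (by simp)
      have hinf : (A.1 \ ⋃ B ∈ I.filter (fun A => ¬ φ.1 A = true), B.1).Infinite := by
        intro hfin
        let N := I.filter (fun A => ¬ φ.1 A = true)
        let C : Fin N.card → ConstrSet X := fun i =>
          ⟨A.1 ∩ (N.equivFin.symm i).1.1, constr_inter A.2 (N.equivFin.symm i).1.2⟩
        have h1 : (symmDiff (A : Set (List α)) (⋃ i, (C i : Set (List α)))).Finite := by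
          refine hfin.subset fun x hx => ?_
          rcases Set.mem_symmDiff.1 hx with ⟨h2, h3⟩ | ⟨h2, h3⟩
          · refine ⟨h2, fun h4 => h3 ?_⟩
            simp only [Set.mem_iUnion] at h4 ⊢
            obtain ⟨B, hB, hx⟩ := h4
            refine ⟨N.equivFin ⟨B, hB⟩, h2, ?_⟩
            rw [Equiv.symm_apply_apply]
            exact hx
          · simp only [Set.mem_iUnion] at h2
            obtain ⟨i, hi⟩ := h2
            exact absurd hi.1 h3
        obtain ⟨i, hi⟩ := (hφ A _ C h1).1 hA
        have h5 := φ.2.2.1 A (N.equivFin.symm i).1 (C i) rfl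
        rw [hi, hA, Bool.true_and] at h5
        exact (Finset.mem_filter.1 (N.equivFin.symm i).2).2 h5.symm
      obtain ⟨ω, hω, h1, h2⟩ := core hcl hsh hi A _ hinf
      refine ⟨mkChar X (Filter.map (pfx ω) Filter.atTop) (ev_exists hcl hsh hω),
        ⟨ω, hω, fun B => ?_⟩, fun B hB => ?_⟩
      · rw [mkChar_iff, finite_iff]; rfl
      · rw [Bool.eq_iff_iff, mkChar_iff]
        by_cases hc : φ.1 B = true
        · refine iff_of_true ?_ hc
          have h3 := hA2 B (Finset.mem_filter.2 ⟨hB, hc⟩)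
          exact h1.mono fun n hn => h3 hn
        · exact iff_of_false (h2 B (Finset.mem_filter.2 ⟨hB, hc⟩)) hc
    · exact closure_sub X
  · intro hE Λ Γ hΛ hΓ hinf
    obtain ⟨U, hU, hS⟩ := exists_uf hinf
    obtain ⟨p, hp, hev⟩ := uf_prefix U hU 1
    have hS' : ∀ᶠ s in (U : Filter (List α)), s ∈ language X ∧ (∀ t ∈ Λ, t ++ s ∈ language X) ∧
            (∀ r ∈ Γ, r ++ s ∉ language X) := hS
    have hp0 : p ≠ [] := by rintro rfl; simp at hp
    obtain ⟨x0, ⟨s0, hs0, rfl⟩, g1, g2, g3⟩ := (hev.and hS').exists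
    have hpL : p ∈ language X := lang_prefix g1 hp0
    let Λ' : Finset (List α) := insert p (Λ.image (· ++ p))
    have hΛ' : ∀ t ∈ Λ', t ∈ language X := by
      intro t ht
      rcases Finset.mem_insert.1 ht with rfl | ht
      · exact hpL
      · obtain ⟨t, ht', rfl⟩ := Finset.mem_image.1 ht
        exact lang_prefix (b := s0) (by simpa using g2 t ht') (by simp [hp0])
    have hpΛ : p ∈ Λ' := by simp [Λ']
    let A : ConstrSet X := ⟨(fun s => p ++ s) '' FLam X Λ',
      Or.inr ⟨Λ', p, fun t ht => Or.inr (hΛ' t ht), ⟨p, hpΛ, hpL⟩, hpΛ, rfl⟩⟩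
    have hAU : A.1 ∈ (U : Filter (List α)) := by
      filter_upwards [hev, hS'] with x hx1 hx2
      obtain ⟨s, hs, rfl⟩ := hx1
      refine ⟨s, ⟨lang_suffix hx2.1 hs, fun t ht => ?_⟩, rfl⟩
      rcases Finset.mem_insert.1 ht with rfl | ht
      · exact hx2.1
      · obtain ⟨t, ht', rfl⟩ := Finset.mem_image.1 ht
        simpa using hx2.2.1 t ht'
    have hB : ∀ r, ∃ B : ConstrSet X, r ++ p ∈ language X →
        B.1 = (fun s => p ++ s) '' FLam X (insert (r ++ p) Λ') := by
      intro r
      by_cases hr : r ++ p ∈ language X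
      · refine ⟨⟨(fun s => p ++ s) '' FLam X (insert (r ++ p) Λ'),
          Or.inr ⟨_, p, ?_, ⟨p, by simp [hpΛ], hpL⟩, by simp [hpΛ], rfl⟩⟩, fun _ => rfl⟩
        intro t ht
        rcases Finset.mem_insert.1 ht with rfl | ht
        · exact Or.inr hr
        · exact Or.inr (hΛ' t ht)
      · exact ⟨A, fun h => absurd h hr⟩
    choose B hB using hB
    have hφ : mkChar X (U : Filter (List α)) ⟨A.1, A.2, hAU⟩ ∈ {φ : CharSp X |
          ∀ (A : ConstrSet X) (n : ℕ) (B : Fin n → ConstrSet X),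
            (symmDiff (A : Set (List α)) (⋃ i, (B i : Set (List α)))).Finite →
            (φ.1 A = true ↔ ∃ i, φ.1 (B i) = true)} := by
      intro A n B h
      simp only [mkChar_iff]
      exact ess_of _ hU (fun A hA => Ultrafilter.frequently_iff_eventually.1 hA) A n B h
    rw [hE, char_closure] at hφ
    obtain ⟨ψ, ⟨ω, hω, h1⟩, h2⟩ := hφ (insert A (Γ.image B))
    have h3 : ∀ C ∈ insert A (Γ.image B), (∀ᶠ n in Filter.atTop, pfx ω n ∈ C.1) ↔
        C.1 ∈ (U : Filter (List α)) := by
      intro C hC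
      rw [← finite_iff, ← h1, h2 C hC, mkChar_iff]
    have h4 := (h3 A (by simp)).2 hAU
    obtain ⟨n, s, -, hs⟩ := h4.exists
    obtain ⟨ω', rfl⟩ := pfx_prefix hs
    have h5 := (ev_wcat hcl hsh p Λ' hpΛ ω').1 h4
    refine ⟨wcat p ω', hω, fun t ht => ?_, fun r hr hc => ?_⟩
    · rw [wcat_append]
      exact h5 _ (Finset.mem_insert_of_mem (Finset.mem_image_of_mem (· ++ p) ht))
    · rw [wcat_append] at hc
      have hrp : r ++ p ∈ language X := lang_prefix (app_mem hc one_ne_zero) (by simp [hp0])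
      have h6 := (h3 (B r) (Finset.mem_insert_of_mem (Finset.mem_image_of_mem B hr))).1 (by
        rw [hB r hrp]
        refine (ev_wcat hcl hsh p _ (by simp [hpΛ]) ω').2 fun t ht => ?_
        rcases Finset.mem_insert.1 ht with rfl | ht
        · exact hc
        · exact h5 t ht)
      rw [hB r hrp] at h6
      have h6' : ∀ᶠ x in (U : Filter (List α)),
        x ∈ (fun s => p ++ s) '' FLam X (insert (r ++ p) Λ') := h6
      obtain ⟨x, ⟨s, hs, rfl⟩, -, -, h7⟩ := (h6'.and hS').exists
      apply h7 r hr
      simpa using hs.2 (r ++ p) (Finset.mem_insert_self _ _)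
end

section
/- In the five-letter subshift X below, for all μ, ν ∈ L_X one has μν ∉ L_X (i.e., ν ∉ F_μ) if and only if there exist a suffix μ′ of μ and a prefix ν′ of ν such that the word μ′ν′ belongs to the forbidden set 𝔉. -/
open Set

variable {α : Type*}

theorem occ_infix {v w : List (Fin 5)} {ω : ℕ → Fin 5} (h : OccursIn w ω) (hv : v <:+: w) :
    OccursIn v ω := by
  obtain ⟨s, t, rfl⟩ := hv
  obtain ⟨k, hk⟩ := h
  refine ⟨k + s.length, fun i => ?_⟩
  have h1 := hk ⟨s.length + i, by have := i.2; simp; omega⟩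
  have hi : (i : ℕ) < v.length := i.2
  simp only [List.get_eq_getElem] at h1 ⊢
  rw [show k + s.length + (i : ℕ) = k + (s.length + i) by omega, ← h1]
  simp [List.getElem_append, hi]

theorem infix_split {v a b : List (Fin 5)} (h : v <:+: a ++ b) :
    v <:+: a ∨ v <:+: b ∨ ∃ p q, v = p ++ q ∧ p <:+ a ∧ q <+: b := by
  obtain ⟨s, t, h⟩ := h
  rw [List.append_assoc, List.append_eq_append_iff] at h
  rcases h with ⟨c, rfl, h⟩ | ⟨c, rfl, rfl⟩
  · rw [List.append_eq_append_iff] at h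
    rcases h with ⟨d, rfl, rfl⟩ | ⟨d, rfl, rfl⟩
    · left; exact ⟨s, d, by simp⟩
    · right; right; exact ⟨c, d, rfl, ⟨s, rfl⟩, ⟨t, rfl⟩⟩
  · right; left; exact ⟨c, t, by simp⟩

theorem forb_tail {a b : List (Fin 5)} {c : Fin 5} (hv : a ++ b ∈ Forb) (hb : b ≠ [])
    (hc : ∀ x ∈ b, x = c) (hc12 : c = 1 ∨ c = 2) :
    (c = 1 ∧ ∃ n, a = 2 :: (List.replicate n 0 ++ [4])) ∨
    (c = 2 ∧ ∃ n, a = 1 :: (List.replicate n 0 ++ [4])) := by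
  obtain ⟨b', d, rfl⟩ := List.eq_nil_or_concat b |>.resolve_left hb
  obtain rfl : d = c := hc d (by simp)
  have key : ∀ (l : List (Fin 5)) (e : Fin 5), a ++ (b' ++ [d]) = l ++ [e] →
      a ++ b' = l ∧ d = e := by
    intro l e h
    rw [← List.append_assoc] at h
    have := List.append_inj' h rfl
    simpa using this
  have key2 : ∀ (l : List (Fin 5)), a ++ b' = l ++ [4] → a = l ++ [4] := by
    intro l h
    rcases List.eq_nil_or_concat b' with rfl | ⟨b'', f, rfl⟩
    · simpa using h
    · rw [List.concat_eq_append, ← List.append_assoc] at h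
      have h2 := (List.append_inj' h rfl).2
      have h3 : f = d := hc f (by simp)
      simp at h2
      subst h3
      rcases hc12 with h | h <;> rw [h] at h2 <;> exact absurd h2 (by decide)
  obtain ⟨n, -, ⟨x, hx, h⟩ | ⟨x, hx, h⟩ | h⟩ := hv
  · obtain ⟨h1, rfl⟩ := key (1 :: (List.replicate n 0 ++ [4])) x (by simpa using h)
    have := key2 (1 :: List.replicate n 0) (by simpa using h1)
    rcases hc12 with rfl | rfl
    · simp at hx
    · right; exact ⟨rfl, n, by simpa using this⟩
  · obtain ⟨h1, rfl⟩ := key (2 :: (List.replicate n 0 ++ [4])) x (by simpa using h)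
    have := key2 (2 :: List.replicate n 0) (by simpa using h1)
    rcases hc12 with rfl | rfl
    · left; exact ⟨rfl, n, by simpa using this⟩
    · simp at hx
  · obtain ⟨h1, h2⟩ := key (3 :: (List.replicate n 0)) 4 (by simpa using h)
    rcases hc12 with h | h <;> rw [h] at h2 <;> exact absurd h2 (by decide)

theorem four_mem {v : List (Fin 5)} (hv : v ∈ Forb) : 4 ∈ v := by
  obtain ⟨n, -, ⟨x, hx, rfl⟩ | ⟨x, hx, rfl⟩ | rfl⟩ := hv <;> simp

theorem ext_mem {w : List (Fin 5)} (c : Fin 5) (hc12 : c = 1 ∨ c = 2)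
    (hno : ∀ v ∈ Forb, ¬ v <:+: w)
    (h1 : c = 1 → ∀ n, ¬ (2 :: (List.replicate n 0 ++ [4])) <:+ w)
    (h2 : c = 2 → ∀ n, ¬ (1 :: (List.replicate n 0 ++ [4])) <:+ w) :
    wcat w (fun _ => c) ∈ X5 := by
  rintro v hv ⟨k, hk⟩
  have hinf : v <:+: w ++ List.replicate (k + v.length) c := by
    have : v = ((w ++ List.replicate (k + v.length) c).drop k).take v.length := by
      apply List.ext_getElem
      · simp; omega
      · intro i hi _
        have := hk ⟨i, hi⟩
        simp only [List.get_eq_getElem, wcat] at this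
        rw [this]
        simp [List.getElem_append]
    refine (List.IsPrefix.isInfix (by
      have h := List.take_prefix v.length ((w ++ List.replicate (k + v.length) c).drop k)
      rwa [← this] at h : v <+: (w ++ List.replicate (k + v.length) c).drop k)).trans ?_
    exact (List.drop_suffix _ _).isInfix
  have h4 : (4 : Fin 5) ≠ c := by rcases hc12 with rfl | rfl <;> decide
  rcases infix_split hinf with h | h | ⟨p, q, rfl, hp, hq⟩
  · exact hno v hv h
  · exact h4 (List.eq_of_mem_replicate (h.subset (four_mem hv)))
  · by_cases hq0 : q = []
    · subst hq0
      exact hno _ hv (by simpa using hp.isInfix)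
    · rcases forb_tail hv hq0 (fun x hx => List.eq_of_mem_replicate (hq.subset hx)) hc12 with
        ⟨hc, n, rfl⟩ | ⟨hc, n, rfl⟩
      · exact h1 hc n hp
      · exact h2 hc n hp

theorem not_both {w : List (Fin 5)} {n m : ℕ}
    (h1 : (1 :: (List.replicate n 0 ++ [4])) <:+ w)
    (h2 : (2 :: (List.replicate m 0 ++ [4])) <:+ w) : False := by
  rcases List.suffix_or_suffix_of_suffix h1 h2 with h | h
  · have := h.subset (List.mem_cons_self)
    simp [List.mem_replicate] at this
  · have := h.subset (List.mem_cons_self)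
    simp [List.mem_replicate] at this

theorem mem_lang_s19 {w : List (Fin 5)} (hw : w ≠ []) (hno : ∀ v ∈ Forb, ¬ v <:+: w) :
    w ∈ language X5 := by
  have occ : ∀ c, OccursIn w (wcat w (fun _ => c)) := fun c => ⟨0, fun i => by simp [wcat]⟩
  refine ⟨hw, ?_⟩
  by_cases h : ∃ n, (1 :: (List.replicate n 0 ++ [4])) <:+ w
  · obtain ⟨n, h⟩ := h
    exact ⟨_, ext_mem 1 (Or.inl rfl) hno (fun _ m hm => not_both h hm)
      (fun h => absurd h (by decide)), occ 1⟩
  · exact ⟨_, ext_mem 2 (Or.inr rfl) hno (fun h => absurd h (by decide))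
      (fun _ m hm => h ⟨m, hm⟩), occ 2⟩

theorem lang_no {w : List (Fin 5)} (hw : w ∈ language X5) : ∀ v ∈ Forb, ¬ v <:+: w := by
  obtain ⟨_, x, hx, ho⟩ := hw
  exact fun v hv hi => hx v hv (occ_infix ho hi)

/-- **Proposition.** In the five-letter subshift `X5`, for all `μ, ν ∈ L_X` one has
`μν ∉ L_X` (i.e. `ν ∉ F_μ`) if and only if there exist a suffix `μ′` of `μ` and a prefix
`ν′` of `ν` such that the word `μ′ν′` belongs to the forbidden set `𝔉`. -/
theorem stmt_19 (μ ν : List (Fin 5)) (hμ : μ ∈ language X5) (hν : ν ∈ language X5) :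
    μ ++ ν ∉ language X5 ↔
      ∃ μ' ν' : List (Fin 5), μ' <:+ μ ∧ ν' <+: ν ∧ μ' ++ ν' ∈ Forb := by
  constructor
  · intro h
    by_contra hcon
    apply h
    refine mem_lang_s19 (by simp [hμ.1]) fun v hv hi => ?_
    rcases infix_split hi with h | h | ⟨p, q, rfl, hp, hq⟩
    · exact lang_no hμ v hv h
    · exact lang_no hν v hv h
    · exact hcon ⟨p, q, hp, hq, hv⟩
  · rintro ⟨p, q, ⟨s, rfl⟩, ⟨t, rfl⟩, hv⟩ hm
    exact lang_no hm _ hv ⟨s, t, by simp⟩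
end
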